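/- arXiv:1701.04321 — 6 statements merged into one kernel-verified Lean document; each statement's English description precedes it below -/
import Mathlib

section
/- For every real ε ∈ (0, 1/2) there exists a real θ > 0 such that the following holds for every positive integer n. Let T be a tournament on [n] and let P be a probability distribution on the set S_n of permutations of [n] such that for every arc (u,v) of T one has P({σ ∈ S_n : σ(u) < σ(v)}) > 1/2 + ε. Then the binary entropy of P satisfies H(P) ≤ (1 − θ)·log₂(n!). -/
open Finset

/-- The probability that `f` takes the value `a` under the weights `P`. -/
noncomputable def fiberProb {Ω α : Type*} [Fintype Ω] [DecidableEq α] (P : Ω → ℝ) (f : Ω → α)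
    (a : α) : ℝ := ∑ ω with f ω = a, P ω

/-- The entropy, in nats, of the random variable `f` under the weights `P`. -/
noncomputable def varEntropy {Ω α : Type*} [Fintype Ω] [DecidableEq α] (P : Ω → ℝ) (f : Ω → α) :
    ℝ := -∑ ω, P ω * Real.log (fiberProb P f (f ω))

section Entropy

variable {Ω α β : Type*} [Fintype Ω] [DecidableEq α] [DecidableEq β] {P : Ω → ℝ}

lemma fiberProb_nonneg (hP : ∀ ω, 0 ≤ P ω) (f : Ω → α) (a : α) : 0 ≤ fiberProb P f a :=
  sum_nonneg fun ω _ => hP ω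

lemma le_fiberProb (hP : ∀ ω, 0 ≤ P ω) (f : Ω → α) (ω : Ω) : P ω ≤ fiberProb P f (f ω) :=
  single_le_sum (f := P) (fun ω _ => hP ω) (by simp)

lemma sum_fiberProb (f : Ω → α) {s : Finset α} (hs : ∀ ω, f ω ∈ s) :
    ∑ a ∈ s, fiberProb P f a = ∑ ω, P ω :=
  sum_fiberwise_of_maps_to (fun ω _ => hs ω) P

/-- Gibbs' inequality. -/
lemma varEntropy_le_of_sum_le_one (hP : ∀ ω, 0 ≤ P ω) (hP1 : ∑ ω, P ω = 1) (f : Ω → α)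
    (q : α → ℝ) (s : Finset α) (hs : ∀ ω, f ω ∈ s) (hq : ∀ a ∈ s, 0 ≤ q a)
    (hq1 : ∑ a ∈ s, q a ≤ 1) (hpos : ∀ ω, 0 < P ω → 0 < q (f ω)) :
    varEntropy P f ≤ -∑ ω, P ω * Real.log (q (f ω)) := by
  have key : ∀ ω, P ω * Real.log (q (f ω)) - P ω * Real.log (fiberProb P f (f ω)) ≤
      P ω * (q (f ω) / fiberProb P f (f ω)) - P ω := by
    intro ω
    rcases (hP ω).eq_or_lt with h | h
    · simp [← h]
    · have h1 := h.trans_le (le_fiberProb hP f ω)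
      have h2 := hpos ω h
      rw [← mul_sub, ← Real.log_div h2.ne' h1.ne', ← mul_sub_one]
      exact mul_le_mul_of_nonneg_left (Real.log_le_sub_one_of_pos (div_pos h2 h1)) h.le
  have h1 := sum_le_sum fun ω (_ : ω ∈ (univ : Finset Ω)) => key ω
  have h2 : ∑ ω, P ω * (q (f ω) / fiberProb P f (f ω)) ≤ 1 := by
    rw [← sum_fiberwise_of_maps_to (fun ω (_ : ω ∈ (univ : Finset Ω)) => hs ω)]
    refine le_trans (sum_le_sum fun a ha => ?_) hq1
    have : ∑ ω with f ω = a, P ω * (q (f ω) / fiberProb P f (f ω)) =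
        fiberProb P f a * (q a / fiberProb P f a) := by
      rw [fiberProb, sum_mul]
      refine sum_congr rfl fun ω hω => ?_
      rw [(mem_filter.1 hω).2, fiberProb]
    rw [this]
    rcases (fiberProb_nonneg hP f a).eq_or_lt with h | h
    · simpa [← h] using hq a ha
    · rw [mul_div_cancel₀ _ h.ne']
  simp only [sum_sub_distrib] at h1
  rw [varEntropy]
  linarith

/-- A variable determined by another one has at most its entropy. -/
lemma varEntropy_le_of_determines (hP : ∀ ω, 0 ≤ P ω) (f : Ω → α) (g : Ω → β)
    (h : ∀ ω ω', f ω = f ω' → g ω = g ω') : varEntropy P g ≤ varEntropy P f := by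
  refine neg_le_neg (sum_le_sum fun ω _ => ?_)
  rcases (hP ω).eq_or_lt with h0 | h0
  · simp [← h0]
  · refine mul_le_mul_of_nonneg_left (Real.log_le_log (h0.trans_le (le_fiberProb hP f ω)) ?_) h0.le
    refine sum_le_sum_of_subset_of_nonneg (fun ω' hω' => ?_) fun ω _ _ => hP ω
    simp only [mem_filter, mem_univ, true_and] at hω' ⊢
    exact h _ _ hω'

/-- Subadditivity of entropy. -/
lemma varEntropy_prod_le (hP : ∀ ω, 0 ≤ P ω) (hP1 : ∑ ω, P ω = 1) (f : Ω → α) (g : Ω → β) :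
    varEntropy P (fun ω => (f ω, g ω)) ≤ varEntropy P f + varEntropy P g := by
  have h := varEntropy_le_of_sum_le_one hP hP1 (fun ω => (f ω, g ω))
    (fun p => fiberProb P f p.1 * fiberProb P g p.2) (univ.image f ×ˢ univ.image g)
    (fun ω => by simp)
    (fun p _ => mul_nonneg (fiberProb_nonneg hP f _) (fiberProb_nonneg hP g _))
    (by
      rw [sum_product, ← sum_mul_sum, sum_fiberProb f (by simp), sum_fiberProb g (by simp), hP1, one_mul])
    (fun ω h => mul_pos (h.trans_le (le_fiberProb hP f ω)) (h.trans_le (le_fiberProb hP g ω)))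
  refine h.trans_eq ?_
  rw [varEntropy, varEntropy, ← neg_add, ← sum_add_distrib]
  congr 1
  refine sum_congr rfl fun ω _ => ?_
  rcases (hP ω).eq_or_lt with h0 | h0
  · simp [← h0]
  · rw [Real.log_mul (h0.trans_le (le_fiberProb hP f ω)).ne'
      (h0.trans_le (le_fiberProb hP g ω)).ne', mul_add]

/-- Entropy is at most the logarithm of the size of the range. -/
lemma varEntropy_le_log_card (hP : ∀ ω, 0 ≤ P ω) (hP1 : ∑ ω, P ω = 1) (f : Ω → α)
    (s : Finset α) (hs : ∀ ω, f ω ∈ s) : varEntropy P f ≤ Real.log s.card := by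
  by_cases h0 : s.card = 0
  · rw [card_eq_zero] at h0
    subst h0
    have : IsEmpty Ω := ⟨fun ω => by simpa using hs ω⟩
    simp [varEntropy]
  have hc : (0 : ℝ) < s.card := by positivity
  refine (varEntropy_le_of_sum_le_one hP hP1 f (fun _ => (s.card : ℝ)⁻¹) s hs
    (fun _ _ => by positivity) (by simp [hc.ne']) (fun _ _ => by positivity)).trans_eq ?_
  rw [← sum_mul, hP1, Real.log_inv]
  ring

/-- The Donsker–Varadhan form of Gibbs' inequality. -/
lemma varEntropy_le_log_sum_exp (hP : ∀ ω, 0 ≤ P ω) (hP1 : ∑ ω, P ω = 1) (f : Ω → α)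
    (s : Finset α) (hs : ∀ ω, f ω ∈ s) (g : α → ℝ) :
    varEntropy P f ≤ Real.log (∑ a ∈ s, Real.exp (g a)) - ∑ ω, P ω * g (f ω) := by
  have hne : s.Nonempty := by
    by_contra h
    rw [not_nonempty_iff_eq_empty] at h
    subst h
    have : IsEmpty Ω := ⟨fun ω => by simpa using hs ω⟩
    simp at hP1
  have hZ : 0 < ∑ a ∈ s, Real.exp (g a) := sum_pos (fun _ _ => Real.exp_pos _) hne
  refine (varEntropy_le_of_sum_le_one hP hP1 f (fun a => Real.exp (g a) / ∑ a ∈ s, Real.exp (g a))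
    s hs (fun _ _ => by positivity) (by rw [← sum_div, div_self hZ.ne'])
    (fun _ _ => by positivity)).trans_eq ?_
  have : ∀ ω, P ω * Real.log (Real.exp (g (f ω)) / ∑ a ∈ s, Real.exp (g a)) =
      P ω * g (f ω) - P ω * Real.log (∑ a ∈ s, Real.exp (g a)) := by
    intro ω
    rw [Real.log_div (Real.exp_pos _).ne' hZ.ne', Real.log_exp, mul_sub]
  simp only [this, sum_sub_distrib]
  rw [← sum_mul, hP1]
  ring

end Entropy

section Ranks

variable {n : ℕ}

/-- The rank of `v` among the elements of `X`, in the order given by `σ`. -/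
def subRank (X : Finset (Fin n)) (σ : Equiv.Perm (Fin n)) (v : Fin n) : ℕ :=
  #{y ∈ X | σ y < σ v}

/-- The order that `σ` induces on `X`, recorded by the ranks. -/
def orderOn (X : Finset (Fin n)) (σ : Equiv.Perm (Fin n)) (v : Fin n) : ℕ :=
  if v ∈ X then subRank X σ v else 0

/-- The ranks that the elements of `A` occupy in the order that `σ` induces on `A ∪ B`. -/
def mergeSet (A B : Finset (Fin n)) (σ : Equiv.Perm (Fin n)) : Finset ℕ :=
  A.image (subRank (A ∪ B) σ)

lemma subRank_lt_subRank_iff {X : Finset (Fin n)} (σ : Equiv.Perm (Fin n)) {u : Fin n}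
    (v : Fin n) (hu : u ∈ X) : subRank X σ u < subRank X σ v ↔ σ u < σ v := by
  constructor
  · intro h
    by_contra hc
    refine h.not_ge (card_le_card fun y hy => ?_)
    simp only [mem_filter] at hy ⊢
    exact ⟨hy.1, hy.2.trans_le (not_lt.1 hc)⟩
  · intro h
    refine card_lt_card ⟨fun y hy => ?_, fun hc => ?_⟩
    · simp only [mem_filter] at hy ⊢
      exact ⟨hy.1, hy.2.trans h⟩
    · have := hc (mem_filter.2 ⟨hu, h⟩)
      simp at this

lemma subRank_injOn (X : Finset (Fin n)) (σ : Equiv.Perm (Fin n)) :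
    Set.InjOn (subRank X σ) X := by
  intro u hu v hv h
  have h1 := (subRank_lt_subRank_iff σ v hu).not.1 h.not_lt
  have h2 := (subRank_lt_subRank_iff σ u hv).not.1 h.not_gt
  exact σ.injective (le_antisymm (not_lt.1 h2) (not_lt.1 h1))

lemma subRank_lt_card {X : Finset (Fin n)} (σ : Equiv.Perm (Fin n)) {v : Fin n} (hv : v ∈ X) :
    subRank X σ v < #X := by
  refine card_lt_card ⟨filter_subset _ _, fun hc => ?_⟩
  have := hc hv
  simp at this

lemma image_subRank (X : Finset (Fin n)) (σ : Equiv.Perm (Fin n)) :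
    X.image (subRank X σ) = range #X := by
  refine eq_of_subset_of_card_le (fun r hr => ?_) ?_
  · obtain ⟨v, hv, rfl⟩ := mem_image.1 hr
    exact mem_range.2 (subRank_lt_card σ hv)
  · rw [card_range, card_image_of_injOn (subRank_injOn X σ)]

lemma mergeSet_mem_powersetCard (A B : Finset (Fin n)) (σ : Equiv.Perm (Fin n)) :
    mergeSet A B σ ∈ powersetCard #A (range #(A ∪ B)) := by
  rw [mem_powersetCard]
  constructor
  · rw [← image_subRank (A ∪ B) σ]
    exact image_subset_image subset_union_left
  · exact card_image_of_injOn ((subRank_injOn (A ∪ B) σ).mono (by simp))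

lemma mergeSet_comm_eq_sdiff {A B : Finset (Fin n)} (h : Disjoint A B)
    (σ : Equiv.Perm (Fin n)) : mergeSet B A σ = range #(A ∪ B) \ mergeSet A B σ := by
  rw [← image_subRank (A ∪ B) σ, mergeSet, mergeSet, union_comm B A]
  ext r
  simp only [mem_image, mem_sdiff]
  constructor
  · rintro ⟨b, hb, rfl⟩
    refine ⟨⟨b, mem_union_right _ hb, rfl⟩, ?_⟩
    rintro ⟨a, ha, hab⟩
    have := subRank_injOn (A ∪ B) σ (mem_coe.2 (mem_union_left _ ha))
      (mem_coe.2 (mem_union_right _ hb)) hab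
    exact disjoint_left.1 h ha (this ▸ hb)
  · rintro ⟨⟨x, hx, rfl⟩, hn⟩
    rcases mem_union.1 hx with hx | hx
    · exact absurd ⟨x, hx, rfl⟩ hn
    · exact ⟨x, hx, rfl⟩

lemma subRank_eq_card_mergeSet_lt (A B : Finset (Fin n)) (σ : Equiv.Perm (Fin n)) (v : Fin n) :
    subRank A σ v = #{w ∈ mergeSet A B σ | w < subRank (A ∪ B) σ v} := by
  rw [mergeSet, filter_image, card_image_of_injOn, subRank]
  · congr 1
    refine filter_congr fun y hy => ?_
    rw [subRank_lt_subRank_iff σ v (mem_union_left _ hy)]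
  · refine (subRank_injOn (A ∪ B) σ).mono fun y hy => ?_
    simp only [coe_filter, Set.mem_ofPred_eq] at hy
    simp [hy.1]

lemma eq_of_card_filter_lt_eq {W : Finset ℕ} {p q : ℕ} (hp : p ∈ W) (hq : q ∈ W)
    (h : #{w ∈ W | w < p} = #{w ∈ W | w < q}) : p = q := by
  have key : ∀ {p q : ℕ}, p ∈ W → p < q → #{w ∈ W | w < p} < #{w ∈ W | w < q} := by
    intro p q hp hpq
    refine card_lt_card ⟨fun y hy => ?_, fun hc => ?_⟩
    · simp only [mem_filter] at hy ⊢
      exact ⟨hy.1, hy.2.trans hpq⟩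
    · have := hc (mem_filter.2 ⟨hp, hpq⟩)
      simp at this
  rcases lt_trichotomy p q with h1 | h1 | h1
  · exact absurd h (key hp h1).ne
  · exact h1
  · exact absurd h (key hq h1).ne'

lemma subRank_union_eq {A B : Finset (Fin n)} {σ τ : Equiv.Perm (Fin n)}
    (hA : orderOn A σ = orderOn A τ) (hW : mergeSet A B σ = mergeSet A B τ) {v : Fin n}
    (hv : v ∈ A) : subRank (A ∪ B) σ v = subRank (A ∪ B) τ v := by
  have h1 : subRank A σ v = subRank A τ v := by
    simpa [orderOn, hv] using congrFun hA v
  rw [subRank_eq_card_mergeSet_lt A B σ, subRank_eq_card_mergeSet_lt A B τ, ← hW] at h1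
  refine eq_of_card_filter_lt_eq (mem_image_of_mem _ hv) ?_ h1
  change _ ∈ mergeSet A B σ
  rw [hW]
  exact mem_image_of_mem _ hv

lemma orderOn_union_eq {A B : Finset (Fin n)} (h : Disjoint A B) {σ τ : Equiv.Perm (Fin n)}
    (hA : orderOn A σ = orderOn A τ) (hB : orderOn B σ = orderOn B τ)
    (hW : mergeSet A B σ = mergeSet A B τ) : orderOn (A ∪ B) σ = orderOn (A ∪ B) τ := by
  funext v
  unfold orderOn
  split_ifs with hv
  · rcases mem_union.1 hv with hv | hv
    · exact subRank_union_eq hA hW hv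
    · rw [union_comm]
      refine subRank_union_eq hB ?_ hv
      rw [mergeSet_comm_eq_sdiff h, mergeSet_comm_eq_sdiff h, hW]
  · rfl

lemma subRank_univ (σ : Equiv.Perm (Fin n)) (v : Fin n) : subRank univ σ v = σ v := by
  have : (univ.filter fun y => σ y < σ v).map σ.toEmbedding = Iio (σ v) := by
    ext y
    simp only [mem_map_equiv, mem_filter, mem_univ, true_and, mem_Iio, Equiv.apply_symm_apply]
  rw [subRank, ← card_map σ.toEmbedding, this, Fin.card_Iio]

lemma orderOn_univ_injective : Function.Injective (orderOn (univ : Finset (Fin n))) := by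
  intro σ τ h
  ext v
  simpa [orderOn, subRank_univ] using congrFun h v

/-- The sign of the comparison of `u` and `v` in the order given by `σ`. -/
noncomputable def orderSign (σ : Equiv.Perm (Fin n)) (u v : Fin n) : ℝ :=
  if σ u < σ v then 1 else if σ v < σ u then -1 else 0

lemma orderSign_antisymm (σ : Equiv.Perm (Fin n)) (u v : Fin n) :
    orderSign σ u v = -orderSign σ v u := by
  unfold orderSign
  rcases lt_trichotomy (σ u) (σ v) with h | h | h
  · simp [h, h.not_gt]
  · simp [h]
  · simp [h, h.not_gt]

lemma sum_sum_orderSign_self (A : Finset (Fin n)) (σ : Equiv.Perm (Fin n)) :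
    ∑ u ∈ A, ∑ v ∈ A, orderSign σ u v = 0 := by
  have h : ∑ u ∈ A, ∑ v ∈ A, orderSign σ u v = -∑ u ∈ A, ∑ v ∈ A, orderSign σ u v := by
    conv_lhs => rw [sum_comm]
    rw [← sum_neg_distrib]
    refine sum_congr rfl fun u _ => ?_
    rw [← sum_neg_distrib]
    exact sum_congr rfl fun v _ => orderSign_antisymm σ v u
  linarith

lemma sum_orderSign_eq {X : Finset (Fin n)} (σ : Equiv.Perm (Fin n)) {v : Fin n} (hv : v ∈ X) :
    ∑ y ∈ X, orderSign σ v y = #X - 1 - 2 * subRank X σ v := by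
  have h1 : ∀ y ∈ X, orderSign σ v y =
      1 - (if y = v then 1 else 0) - 2 * (if σ y < σ v then 1 else 0) := by
    intro y _
    unfold orderSign
    rcases lt_trichotomy (σ v) (σ y) with h | h | h
    · have : y ≠ v := fun e => by simp [e] at h
      simp [h, h.not_gt, this]
    · have := σ.injective h
      simp [this]
    · have : y ≠ v := fun e => by simp [e] at h
      simp [h, h.not_gt, this]
      norm_num
  rw [sum_congr rfl h1, sum_sub_distrib, sum_sub_distrib, ← mul_sum, subRank, card_filter]
  simp [hv]

/-- The signed count of ordered pairs between `A` and `B` is a linear statistic of the merge. -/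
lemma sum_sum_orderSign_eq {A B : Finset (Fin n)} (h : Disjoint A B) (σ : Equiv.Perm (Fin n)) :
    ∑ u ∈ A, ∑ v ∈ B, orderSign σ u v =
      ∑ p ∈ mergeSet A B σ, ((#(A ∪ B) : ℝ) - 1 - 2 * p) := by
  rw [mergeSet, sum_image ((subRank_injOn (A ∪ B) σ).mono (by simp))]
  have h1 : ∀ u ∈ A, ((#(A ∪ B) : ℝ) - 1 - 2 * (subRank (A ∪ B) σ u : ℕ)) =
      ∑ v ∈ A, orderSign σ u v + ∑ v ∈ B, orderSign σ u v := by
    intro u hu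
    rw [← sum_orderSign_eq σ (mem_union_left _ hu), sum_union h]
  rw [sum_congr rfl h1, sum_add_distrib, sum_sum_orderSign_self, zero_add]

end Ranks

section Saving

variable {n : ℕ} {P : Equiv.Perm (Fin n) → ℝ}

/-- The entropy deficit, compared to the uniform order, of the order induced on `X`. -/
noncomputable def entropySaving (P : Equiv.Perm (Fin n) → ℝ) (X : Finset (Fin n)) : ℝ :=
  Real.log (#X).factorial - varEntropy P (orderOn X)

/-- The expected signed count of ordered pairs between `A` and `B`. -/
noncomputable def expectedSign (P : Equiv.Perm (Fin n) → ℝ) (A B : Finset (Fin n)) : ℝ :=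
  ∑ σ, P σ * ∑ u ∈ A, ∑ v ∈ B, orderSign σ u v

lemma expectedSign_eq (P : Equiv.Perm (Fin n) → ℝ) (A B : Finset (Fin n)) :
    expectedSign P A B = ∑ u ∈ A, ∑ v ∈ B, ∑ σ, P σ * orderSign σ u v := by
  unfold expectedSign
  simp only [mul_sum]
  rw [sum_comm]
  exact sum_congr rfl fun u _ => sum_comm

lemma expectedSign_swap (P : Equiv.Perm (Fin n) → ℝ) (A B : Finset (Fin n)) :
    expectedSign P A B = -expectedSign P B A := by
  unfold expectedSign
  rw [← sum_neg_distrib]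
  refine sum_congr rfl fun σ _ => ?_
  rw [sum_comm, ← mul_neg, ← sum_neg_distrib]
  congr 1
  refine sum_congr rfl fun v _ => ?_
  rw [← sum_neg_distrib]
  exact sum_congr rfl fun u _ => orderSign_antisymm σ u v

lemma log_factorial_add (a b : ℕ) : Real.log (a + b).factorial =
    Real.log a.factorial + Real.log b.factorial + Real.log ((a + b).choose a) := by
  have h := Nat.add_choose_mul_factorial_mul_factorial a b
  have ha : ((a.factorial : ℕ) : ℝ) ≠ 0 := by positivity
  have hb : ((b.factorial : ℕ) : ℝ) ≠ 0 := by positivity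
  have hc : (((a + b).choose a : ℕ) : ℝ) ≠ 0 := by
    exact_mod_cast (Nat.choose_pos (Nat.le_add_right a b)).ne'
  rw [Nat.choose_symm_add] at hc ⊢
  rw [← h]
  push_cast
  rw [Real.log_mul (mul_ne_zero hc ha) hb, Real.log_mul hc ha]
  ring

lemma add_entropySaving_add_le (hP : ∀ σ, 0 ≤ P σ) (hP1 : ∑ σ, P σ = 1)
    {A B : Finset (Fin n)} (h : Disjoint A B) :
    entropySaving P A + entropySaving P B +
      (Real.log ((#A + #B).choose #A) - varEntropy P (mergeSet A B)) ≤
        entropySaving P (A ∪ B) := by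
  have h1 := varEntropy_le_of_determines hP
    (fun σ => (orderOn A σ, (orderOn B σ, mergeSet A B σ))) (orderOn (A ∪ B)) (by
      intro σ τ hst
      simp only [Prod.mk.injEq] at hst
      exact orderOn_union_eq h hst.1 hst.2.1 hst.2.2)
  have h2 := varEntropy_prod_le hP hP1 (orderOn A) (fun σ => (orderOn B σ, mergeSet A B σ))
  have h3 := varEntropy_prod_le hP hP1 (orderOn B) (mergeSet A B)
  unfold entropySaving
  rw [card_union_of_disjoint h, log_factorial_add]
  linarith

/-- Superadditivity of the entropy deficit. -/
lemma entropySaving_add_le (hP : ∀ σ, 0 ≤ P σ) (hP1 : ∑ σ, P σ = 1)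
    {A B : Finset (Fin n)} (h : Disjoint A B) :
    entropySaving P A + entropySaving P B ≤ entropySaving P (A ∪ B) := by
  have h1 := varEntropy_le_log_card hP hP1 (mergeSet A B) _ (mergeSet_mem_powersetCard A B)
  rw [card_powersetCard, card_range, card_union_of_disjoint h] at h1
  linarith [add_entropySaving_add_le hP hP1 h]

lemma entropySaving_nonneg (hP : ∀ σ, 0 ≤ P σ) (hP1 : ∑ σ, P σ = 1) (X : Finset (Fin n)) :
    0 ≤ entropySaving P X := by
  have hsmall : ∀ Y : Finset (Fin n), #Y ≤ 1 → 0 ≤ entropySaving P Y := by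
    intro Y hY
    have h0 : ∀ σ, orderOn Y σ = fun _ => 0 := by
      intro σ
      funext v
      unfold orderOn
      split_ifs with hv
      · have := subRank_lt_card σ hv
        lia
      · rfl
    have h1 := varEntropy_le_log_card hP hP1 (orderOn Y) {fun _ => 0} (by simp [h0])
    have h2 : 0 ≤ Real.log (#Y).factorial := Real.log_natCast_nonneg _
    simp only [card_singleton, Nat.cast_one, Real.log_one] at h1
    unfold entropySaving
    linarith
  induction X using Finset.induction_on with
  | empty => exact hsmall _ (by simp)
  | insert v X hv ih =>
    have := entropySaving_add_le hP hP1 (disjoint_singleton_left.2 hv)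
    rw [← insert_eq] at this
    linarith [hsmall {v} (by simp)]

lemma entropySaving_mono (hP : ∀ σ, 0 ≤ P σ) (hP1 : ∑ σ, P σ = 1) {X Y : Finset (Fin n)}
    (h : X ⊆ Y) : entropySaving P X ≤ entropySaving P Y := by
  have h1 := entropySaving_add_le hP hP1 (disjoint_sdiff : Disjoint X (Y \ X))
  rw [union_sdiff_of_subset h] at h1
  linarith [entropySaving_nonneg hP hP1 (Y \ X)]

lemma varEntropy_mergeSet_le (hP : ∀ σ, 0 ≤ P σ) (hP1 : ∑ σ, P σ = 1)
    {A B : Finset (Fin n)} (h : Disjoint A B) (t : ℝ) :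
    varEntropy P (mergeSet A B) ≤
      Real.log (∑ S ∈ powersetCard #A (range (#A + #B)),
        Real.exp (∑ p ∈ S, t * ((#A + #B : ℕ) - 1 - 2 * p))) - t * expectedSign P A B := by
  have h1 := varEntropy_le_log_sum_exp hP hP1 (mergeSet A B) _ (mergeSet_mem_powersetCard A B)
    (fun S => ∑ p ∈ S, t * ((#A + #B : ℕ) - 1 - 2 * p))
  rw [card_union_of_disjoint h] at h1
  refine h1.trans_eq ?_
  congr 1
  rw [expectedSign, mul_sum]
  refine sum_congr rfl fun σ _ => ?_
  rw [sum_sum_orderSign_eq h, card_union_of_disjoint h, ← mul_sum]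
  ring

lemma sum_range_sub_one_sub_two_mul (N : ℕ) : ∑ p ∈ range N, ((N : ℝ) - 1 - 2 * p) = 0 := by
  have h := sum_range_reflect (fun p : ℕ => (N : ℝ) - 1 - 2 * p) N
  have h2 : ∑ p ∈ range N, ((N : ℝ) - 1 - 2 * (N - 1 - p : ℕ)) =
      -∑ p ∈ range N, ((N : ℝ) - 1 - 2 * p) := by
    rw [← sum_neg_distrib]
    refine sum_congr rfl fun p hp => ?_
    have := mem_range.1 hp
    rw [Nat.sub_sub, Nat.cast_sub (by lia)]
    push_cast
    ring
  linarith

lemma one_add_exp_le (x : ℝ) : 1 + Real.exp x ≤ 2 * Real.exp (x / 2 + x ^ 2 / 8) := by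
  have h := Real.cosh_le_exp_half_sq (x / 2)
  rw [Real.cosh_eq] at h
  have h1 : 1 + Real.exp x = Real.exp (x / 2) * (Real.exp (x / 2) + Real.exp (-(x / 2))) := by
    rw [mul_add, ← Real.exp_add, ← Real.exp_add]
    simp
    ring
  rw [h1, Real.exp_add, show x ^ 2 / 8 = (x / 2) ^ 2 / 2 by ring]
  nlinarith [Real.exp_pos (x / 2)]

lemma sum_powersetCard_exp_le (m : ℕ) (t : ℝ) :
    ∑ S ∈ powersetCard m (range (m + m)),
      Real.exp (∑ p ∈ S, t * ((m + m : ℕ) - 1 - 2 * p)) ≤ 4 ^ m * Real.exp (t ^ 2 * m ^ 3) := by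
  calc _ ≤ ∑ S ∈ (range (m + m)).powerset,
        Real.exp (∑ p ∈ S, t * ((m + m : ℕ) - 1 - 2 * p)) :=
        sum_le_sum_of_subset_of_nonneg (fun S hS => mem_powerset.2 (mem_powersetCard.1 hS).1)
          fun _ _ _ => (Real.exp_pos _).le
    _ = ∏ p ∈ range (m + m), (1 + Real.exp (t * ((m + m : ℕ) - 1 - 2 * p))) := by
        rw [prod_one_add]
        exact sum_congr rfl fun S _ => Real.exp_sum _ _
    _ ≤ ∏ p ∈ range (m + m), (2 * Real.exp (t * ((m + m : ℕ) - 1 - 2 * p) / 2 +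
          (t * ((m + m : ℕ) - 1 - 2 * p)) ^ 2 / 8)) :=
        prod_le_prod (fun _ _ => by positivity) fun p _ => one_add_exp_le _
    _ = 4 ^ m * Real.exp (∑ p ∈ range (m + m), (t * ((m + m : ℕ) - 1 - 2 * p)) ^ 2 / 8) := by
        rw [prod_mul_distrib, prod_const, card_range, ← Real.exp_sum, sum_add_distrib,
          ← sum_div, ← mul_sum, sum_range_sub_one_sub_two_mul, pow_add, ← mul_pow]
        norm_num
    _ ≤ _ := by
        refine mul_le_mul_of_nonneg_left (Real.exp_le_exp.2 ?_) (by positivity)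
        have : ∀ p ∈ range (m + m), (t * ((m + m : ℕ) - 1 - 2 * p)) ^ 2 / 8 ≤
            t ^ 2 * m ^ 2 / 2 := by
          intro p hp
          have h1 : (p : ℝ) + 1 ≤ m + m := by exact_mod_cast mem_range.1 hp
          have h0 : (0 : ℝ) ≤ p := by positivity
          have h2 : (((m + m : ℕ) : ℝ) - 1 - 2 * p) ^ 2 ≤ (2 * m) ^ 2 := by
            push_cast
            apply sq_le_sq' <;> linarith
          rw [mul_pow]
          nlinarith [sq_nonneg t]
        refine (sum_le_sum this).trans_eq ?_
        rw [sum_const, card_range, nsmul_eq_mul]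
        push_cast
        ring

/-- A merge of two sets of size `m` with a biased expected order saves entropy linear in `m`. -/
lemma add_entropySaving_of_abs_expectedSign (hP : ∀ σ, 0 ≤ P σ) (hP1 : ∑ σ, P σ = 1)
    {A B : Finset (Fin n)} (h : Disjoint A B) {m : ℕ} (hm : 0 < m) (hA : #A = m) (hB : #B = m)
    {ε : ℝ} (hε : 0 < ε) (hE : ε * m ^ 2 ≤ |expectedSign P A B|) :
    entropySaving P A + entropySaving P B + (ε ^ 2 * m / 4 - Real.log (2 * m)) ≤
      entropySaving P (A ∪ B) := by
  have hm' : (0 : ℝ) < m := by exact_mod_cast hm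
  obtain ⟨t, ht2, htE⟩ : ∃ t : ℝ, t ^ 2 = (ε / (2 * m)) ^ 2 ∧
      ε / (2 * m) * (ε * m ^ 2) ≤ t * expectedSign P A B := by
    have hpos : 0 ≤ ε / (2 * m) := by positivity
    rcases abs_cases (expectedSign P A B) with ⟨h1, _⟩ | ⟨h1, _⟩
    · exact ⟨ε / (2 * m), rfl, mul_le_mul_of_nonneg_left (h1 ▸ hE) hpos⟩
    · refine ⟨-(ε / (2 * m)), by ring, ?_⟩
      rw [neg_mul_comm]
      exact mul_le_mul_of_nonneg_left (h1 ▸ hE) hpos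
  have h1 := varEntropy_mergeSet_le hP hP1 h t
  have h2 := add_entropySaving_add_le hP hP1 h
  rw [hA, hB] at h1 h2
  have hZpos : 0 < ∑ S ∈ powersetCard m (range (m + m)),
      Real.exp (∑ p ∈ S, t * ((m + m : ℕ) - 1 - 2 * p)) :=
    sum_pos (fun _ _ => Real.exp_pos _) (powersetCard_nonempty.2 (by simp))
  have h3 := Real.log_le_log hZpos (sum_powersetCard_exp_le m t)
  rw [Real.log_mul (by positivity) (by positivity), Real.log_exp, ht2] at h3
  have h4 : Real.log (4 ^ m) ≤ Real.log (2 * m) + Real.log ((m + m).choose m) := by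
    have hc : (0 : ℝ) < (m + m).choose m := by
      exact_mod_cast Nat.choose_pos (Nat.le_add_right m m)
    rw [← Real.log_mul (by positivity) hc.ne']
    refine Real.log_le_log (by positivity) ?_
    have := Nat.four_pow_le_two_mul_self_mul_centralBinom m hm
    rw [Nat.centralBinom, two_mul m] at this
    have h' : ((4 ^ m : ℕ) : ℝ) ≤ ((m + m) * (m + m).choose m : ℕ) := by exact_mod_cast this
    push_cast at h'
    rw [two_mul]
    exact h'
  have h5 : (ε / (2 * m)) ^ 2 * m ^ 3 = ε ^ 2 * m / 4 := by field_simp; ring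
  have h6 : ε / (2 * m) * (ε * m ^ 2) = ε ^ 2 * m / 2 := by field_simp
  linarith

lemma entropySaving_pair (hP : ∀ σ, 0 ≤ P σ) (hP1 : ∑ σ, P σ = 1) {u v : Fin n} (huv : u ≠ v)
    {ε : ℝ} (hε : 0 < ε) (hE : 2 * ε ≤ |∑ σ, P σ * orderSign σ u v|) :
    2 * ε ^ 2 ≤ entropySaving P ({u} ∪ {v}) := by
  obtain ⟨t, ht2, htE⟩ : ∃ t : ℝ, t ^ 2 = (2 * ε) ^ 2 ∧
      2 * ε * (2 * ε) ≤ t * ∑ σ, P σ * orderSign σ u v := by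
    rcases abs_cases (∑ σ, P σ * orderSign σ u v) with ⟨h1, _⟩ | ⟨h1, _⟩
    · exact ⟨2 * ε, rfl, mul_le_mul_of_nonneg_left (h1 ▸ hE) (by linarith)⟩
    · refine ⟨-(2 * ε), by ring, ?_⟩
      rw [neg_mul_comm]
      exact mul_le_mul_of_nonneg_left (h1 ▸ hE) (by linarith)
  have hd : Disjoint ({u} : Finset (Fin n)) {v} := by simpa using huv
  have h1 := varEntropy_mergeSet_le hP hP1 hd t
  have h2 := add_entropySaving_add_le hP hP1 hd
  have h3 := entropySaving_nonneg hP hP1 {u}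
  have h4 := entropySaving_nonneg hP hP1 {v}
  have h5 : powersetCard 1 (range (1 + 1)) = {{0}, {1}} := by decide
  simp only [card_singleton, h5, expectedSign, sum_singleton] at h1 h2
  rw [sum_pair (by decide), sum_singleton, sum_singleton] at h1
  have h6 : Real.exp (t * (((1 + 1 : ℕ) : ℝ) - 1 - 2 * (0 : ℕ))) +
      Real.exp (t * (((1 + 1 : ℕ) : ℝ) - 1 - 2 * (1 : ℕ))) ≤ 2 * Real.exp (t ^ 2 / 2) := by
    have h := Real.cosh_le_exp_half_sq t
    rw [Real.cosh_eq] at h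
    norm_num
    linarith
  have h7 := Real.log_le_log (by positivity) h6
  rw [Real.log_mul (by norm_num) (by positivity), Real.log_exp, ht2] at h7
  simp only [show (1 + 1).choose 1 = 2 from rfl, Nat.cast_ofNat] at h2
  have h8 := h1.trans (sub_le_sub_right h7 _)
  linarith

end Saving

section Regularity

variable {V : Type*}

/-- The normalized sum of `f` over the rectangle `A × B`. -/
noncomputable def rectAvg (f : V → V → ℝ) (A B : Finset V) : ℝ :=
  (∑ u ∈ A, ∑ v ∈ B, f u v) / (#A * #B)

lemma abs_rectAvg_le_one {f : V → V → ℝ} (hf : ∀ u v, |f u v| ≤ 1) (A B : Finset V) :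
    |rectAvg f A B| ≤ 1 := by
  rw [rectAvg, abs_div, abs_of_nonneg (by positivity : (0 : ℝ) ≤ #A * #B)]
  refine div_le_one_of_le₀ ?_ (by positivity)
  calc _ ≤ ∑ u ∈ A, |∑ v ∈ B, f u v| := abs_sum_le_sum_abs _ _
    _ ≤ ∑ u ∈ A, ∑ v ∈ B, |f u v| := sum_le_sum fun u _ => abs_sum_le_sum_abs _ _
    _ ≤ ∑ u ∈ A, ∑ v ∈ B, (1 : ℝ) := sum_le_sum fun u _ => sum_le_sum fun v _ => hf u v
    _ = _ := by simp

lemma sum_sum_sub_const (f : V → V → ℝ) (d : ℝ) (A B : Finset V) :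
    ∑ u ∈ A, ∑ v ∈ B, (f u v - d) = ∑ u ∈ A, ∑ v ∈ B, f u v - #A * #B * d := by
  simp only [sum_sub_distrib, sum_const, nsmul_eq_mul]
  ring

lemma sum_sum_eq_mul_rectAvg (f : V → V → ℝ) {A B : Finset V} (hA : A.Nonempty)
    (hB : B.Nonempty) : ∑ u ∈ A, ∑ v ∈ B, f u v = #A * #B * rectAvg f A B := by
  have := hA.card_pos
  have := hB.card_pos
  rw [rectAvg]
  field_simp

/-- Any two disjoint sets can be replaced by a pair of comparable size that has no subrectangle
with a large excess over the average. -/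
lemma exists_upper_regular_pair [DecidableEq V] {f : V → V → ℝ} (hf : ∀ u v, |f u v| ≤ 1) {η : ℝ} (hη : 0 < η)
    {X A₀ B₀ : Finset V} (hA₀ : A₀ ⊆ X) (hB₀ : B₀ ⊆ X) (h₀ : Disjoint A₀ B₀)
    (hA₀n : A₀.Nonempty) (hB₀n : B₀.Nonempty) :
    ∃ A ⊆ X, ∃ B ⊆ X, Disjoint A B ∧ A.Nonempty ∧ B.Nonempty ∧
      Real.exp (-2 / η) * (#A₀ * #B₀) ≤ #A * #B ∧
      ∀ A' ⊆ A, ∀ B' ⊆ B, ∑ u ∈ A', ∑ v ∈ B', (f u v - rectAvg f A B) ≤ η * (#A * #B) := by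
  obtain ⟨⟨A, B⟩, hmem, hmax⟩ := exists_max_image
    ((X.powerset ×ˢ X.powerset).filter fun p => Disjoint p.1 p.2 ∧ p.1.Nonempty ∧ p.2.Nonempty)
    (fun p => rectAvg f p.1 p.2 + η * Real.log (#p.1 * #p.2))
    ⟨(A₀, B₀), by simp [hA₀, hB₀, h₀, hA₀n, hB₀n]⟩
  simp only [mem_filter, mem_product, mem_powerset, Prod.forall] at hmem hmax
  obtain ⟨⟨hAX, hBX⟩, hd, hA, hB⟩ := hmem
  have hpos : ∀ {C D : Finset V}, C.Nonempty → D.Nonempty → (0 : ℝ) < #C * #D := by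
    intro C D hC hD
    have := hC.card_pos
    have := hD.card_pos
    positivity
  refine ⟨A, hAX, B, hBX, hd, hA, hB, ?_, fun A' hA' B' hB' => ?_⟩
  · have h1 := hmax A₀ B₀ ⟨⟨hA₀, hB₀⟩, h₀, hA₀n, hB₀n⟩
    have h2 := abs_le.1 (abs_rectAvg_le_one hf A B)
    have h3 := abs_le.1 (abs_rectAvg_le_one hf A₀ B₀)
    rw [← Real.log_le_log_iff (mul_pos (Real.exp_pos _) (hpos hA₀n hB₀n)) (hpos hA hB),
      Real.log_mul (Real.exp_pos _).ne' (hpos hA₀n hB₀n).ne', Real.log_exp]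
    have h4 : η * (-2 / η) = -2 := by field_simp
    refine le_of_mul_le_mul_left ?_ hη
    rw [mul_add, h4]
    linarith
  · rcases A'.eq_empty_or_nonempty with rfl | hA'n
    · simp only [sum_empty]
      exact mul_nonneg hη.le (hpos hA hB).le
    rcases B'.eq_empty_or_nonempty with rfl | hB'n
    · simp only [sum_empty, sum_const_zero]
      exact mul_nonneg hη.le (hpos hA hB).le
    have h1 := hmax A' B' ⟨⟨hA'.trans hAX, hB'.trans hBX⟩,
      disjoint_of_subset_left hA' (disjoint_of_subset_right hB' hd), hA'n, hB'n⟩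
    have hp := hpos hA hB
    have hp' := hpos hA'n hB'n
    rw [sum_sum_sub_const, sum_sum_eq_mul_rectAvg f hA'n hB'n, ← mul_sub]
    have h2 : rectAvg f A' B' - rectAvg f A B ≤ η * (#A * #B / (#A' * #B')) := by
      have h3 := Real.log_le_sub_one_of_pos (div_pos hp hp')
      rw [Real.log_div hp.ne' hp'.ne'] at h3
      nlinarith
    calc _ ≤ (#A' * #B' : ℝ) * (η * (#A * #B / (#A' * #B'))) :=
          mul_le_mul_of_nonneg_left h2 hp'.le
      _ = _ := by
          have := hp'.ne'
          field_simp

/-- Some subset of size `k` has at least the average sum. -/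
lemma exists_subset_card_eq_mul_sum_le [DecidableEq V] (y : V → ℝ) {k : ℕ} (A : Finset V) (hk : k ≤ #A) :
    ∃ A' ⊆ A, #A' = k ∧ k * ∑ u ∈ A, y u ≤ #A * ∑ u ∈ A', y u := by
  induction hc : #A - k generalizing A with
  | zero => exact ⟨A, Subset.rfl, by lia, by rw [show k = #A by lia]⟩
  | succ j ih =>
    rcases Nat.eq_zero_or_pos k with rfl | hk0
    · exact ⟨∅, empty_subset _, rfl, by simp⟩
    obtain ⟨z, hz, hmin⟩ := exists_min_image A y (card_pos.1 (by lia))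
    have hce := card_erase_of_mem hz
    obtain ⟨A', hA', hA'k, hsum⟩ := ih (A.erase z) (by lia) (by lia)
    refine ⟨A', hA'.trans (erase_subset _ _), hA'k, ?_⟩
    have h1 : #A * y z ≤ ∑ u ∈ A, y u := by
      simpa using card_nsmul_le_sum A y (y z) hmin
    have h2 : ∑ u ∈ A.erase z, y u = ∑ u ∈ A, y u - y z := sum_erase_eq_sub hz
    have h3 : ((#(A.erase z) : ℕ) : ℝ) = #A - 1 := by
      rw [hce, Nat.cast_sub (by lia), Nat.cast_one]
    rw [h3] at hsum
    have h4 : (0 : ℝ) < #A - 1 := by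
      have : (2 : ℝ) ≤ #A := by exact_mod_cast (show 2 ≤ #A by lia)
      linarith
    have hk0' : (0 : ℝ) < k := by exact_mod_cast hk0
    refine le_of_mul_le_mul_left ?_ h4
    have h5 : (#A - 1 : ℝ) * ∑ u ∈ A, y u ≤ #A * ∑ u ∈ A.erase z, y u := by
      rw [h2]
      linarith
    calc _ = k * ((#A - 1 : ℝ) * ∑ u ∈ A, y u) := by ring
      _ ≤ k * (#A * ∑ u ∈ A.erase z, y u) := mul_le_mul_of_nonneg_left h5 hk0'.le
      _ = #A * (k * ∑ u ∈ A.erase z, y u) := by ring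
      _ ≤ #A * ((#A - 1 : ℝ) * ∑ u ∈ A', y u) := mul_le_mul_of_nonneg_left hsum (by positivity)
      _ = _ := by ring

end Regularity

section Staircase

variable {n : ℕ}

lemma card_filter_subRank_div_eq_le (A : Finset (Fin n)) (σ : Equiv.Perm (Fin n)) {L : ℕ}
    (hL : 0 < L) (j : ℕ) : #{u ∈ A | subRank A σ u / L = j} ≤ L := by
  have h : #{u ∈ A | subRank A σ u / L = j} ≤ #(Ico (j * L) (j * L + L)) := by
    refine card_le_card_of_injOn (subRank A σ) (fun u hu => ?_)
      ((subRank_injOn A σ).mono (coe_subset.2 (filter_subset _ _)))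
    simp only [coe_filter, Set.mem_ofPred_eq] at hu
    obtain ⟨_, rfl⟩ := hu
    rw [mem_coe, mem_Ico]
    have := Nat.div_add_mod' (subRank A σ u) L
    have := Nat.mod_lt (subRank A σ u) hL
    lia
  simpa using h

/-- If no subrectangle has a large sum, then neither has the set of pairs ordered by `σ`. -/
lemma sum_sum_ite_lt_le {F : Fin n → Fin n → ℝ} (hF : ∀ u v, |F u v| ≤ 2)
    {A B : Finset (Fin n)} {δ : ℝ}
    (hreg : ∀ A' ⊆ A, ∀ B' ⊆ B, ∑ u ∈ A', ∑ v ∈ B', F u v ≤ δ) {L : ℕ} (hL : 0 < L)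
    (σ : Equiv.Perm (Fin n)) :
    ∑ u ∈ A, ∑ v ∈ B, (if σ u < σ v then F u v else 0) ≤
      (#A / L + 1 : ℕ) * δ + 2 * L * #B := by
  have h1 : ∀ u ∈ A, ∀ v ∈ B, (if σ u < σ v then F u v else 0) ≤
      (if subRank A σ u / L < subRank A σ v / L then F u v else 0) +
        (if subRank A σ u / L = subRank A σ v / L then 2 else 0) := by
    intro u hu v _
    have hb := abs_le.1 (hF u v)
    simp only [← subRank_lt_subRank_iff σ v hu]
    rcases lt_trichotomy (subRank A σ u / L) (subRank A σ v / L) with h | h | h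
    · simp [h, h.ne, lt_of_not_ge fun hc => h.not_ge (Nat.div_le_div_right hc)]
    · rw [if_neg h.not_lt, if_pos h]
      split_ifs <;> linarith
    · have := lt_of_not_ge fun hc => h.not_ge (Nat.div_le_div_right (c := L) hc)
      simp [h.ne', h.not_gt, this.not_gt]
  have h2 : ∑ u ∈ A, ∑ v ∈ B, (if subRank A σ u / L < subRank A σ v / L then F u v else 0) ≤
      (#A / L + 1 : ℕ) * δ := by
    have hmaps : ∀ u ∈ A, subRank A σ u / L ∈ range (#A / L + 1) := by
      intro u hu
      have := Nat.div_le_div_right (c := L) (subRank_lt_card σ hu).le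
      rw [mem_range]
      lia
    rw [← sum_fiberwise_of_maps_to hmaps]
    have : ∀ i ∈ range (#A / L + 1), ∑ u ∈ A with subRank A σ u / L = i,
        ∑ v ∈ B, (if subRank A σ u / L < subRank A σ v / L then F u v else 0) ≤ δ := by
      intro i _
      refine le_trans (le_of_eq ?_) (hreg {u ∈ A | subRank A σ u / L = i} (filter_subset _ _)
        {v ∈ B | i < subRank A σ v / L} (filter_subset _ _))
      refine sum_congr rfl fun u hu => ?_
      rw [(mem_filter.1 hu).2, sum_filter]
    refine (sum_le_sum this).trans_eq ?_
    rw [sum_const, card_range, nsmul_eq_mul]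
  have h3 : ∑ u ∈ A, ∑ v ∈ B,
      (if subRank A σ u / L = subRank A σ v / L then (2 : ℝ) else 0) ≤ 2 * L * #B := by
    rw [sum_comm]
    have : ∀ v ∈ B, ∑ u ∈ A, (if subRank A σ u / L = subRank A σ v / L then (2 : ℝ) else 0) ≤
        2 * L := by
      intro v _
      rw [← sum_filter, sum_const, nsmul_eq_mul, mul_comm]
      have : (#{u ∈ A | subRank A σ u / L = subRank A σ v / L} : ℝ) ≤ L := by
        exact_mod_cast card_filter_subRank_div_eq_le A σ hL _
      linarith
    refine (sum_le_sum this).trans_eq ?_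
    rw [sum_const, nsmul_eq_mul]
    ring
  have h4 := sum_le_sum fun u hu => sum_le_sum fun v hv => h1 u hu v hv
  simp only [sum_add_distrib] at h4
  linarith

lemma orderSign_eq_of_ne (σ : Equiv.Perm (Fin n)) {u v : Fin n} (h : u ≠ v) :
    orderSign σ u v = 2 * (if σ u < σ v then 1 else 0) - 1 := by
  unfold orderSign
  rcases lt_trichotomy (σ u) (σ v) with h1 | h1 | h1
  · simp [h1]
    norm_num
  · exact absurd (σ.injective h1) h
  · simp [h1, h1.not_gt]

lemma sum_sum_mul_orderSign_le {f : Fin n → Fin n → ℝ} (hf : ∀ u v, |f u v| ≤ 1)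
    {ε : ℝ} (hε : 0 < ε) (hε1 : ε ≤ 1) {A B : Finset (Fin n)} (hd : Disjoint A B)
    (hAn : A.Nonempty) (hBn : B.Nonempty) (hA : 8 ≤ ε * #A)
    (hreg : ∀ A' ⊆ A, ∀ B' ⊆ B,
      ∑ u ∈ A', ∑ v ∈ B', (f u v - rectAvg f A B) ≤ ε ^ 2 / 68 * (#A * #B))
    (σ : Equiv.Perm (Fin n)) :
    ∑ u ∈ A, ∑ v ∈ B, (f u v - rectAvg f A B) * orderSign σ u v ≤ ε * (#A * #B) := by
  have hd1 := abs_le.1 (abs_rectAvg_le_one hf A B)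
  have hF : ∀ u v, |f u v - rectAvg f A B| ≤ 2 := by
    intro u v
    have := abs_le.1 (hf u v)
    rw [abs_le]
    constructor <;> linarith
  have hApos : (0 : ℝ) < #A := by exact_mod_cast hAn.card_pos
  have hBpos : (0 : ℝ) < #B := by exact_mod_cast hBn.card_pos
  set L := ⌊ε * #A / 8⌋₊ with hLdef
  have hL : 0 < L := Nat.floor_pos.2 (by linarith)
  have hLle : (L : ℝ) ≤ ε * #A / 8 := Nat.floor_le (by positivity)
  have hLge : ε * #A / 16 ≤ L := by
    have h1 : (1 : ℝ) ≤ L := by exact_mod_cast hL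
    have h2 := Nat.lt_floor_add_one (ε * #A / 8)
    rw [← hLdef] at h2
    linarith
  have hk : ((#A / L + 1 : ℕ) : ℝ) ≤ 17 / ε := by
    have h1 : ((#A / L : ℕ) : ℝ) ≤ #A / L := Nat.cast_div_le
    have h2 : (#A : ℝ) / L ≤ 16 / ε := by
      rw [div_le_div_iff₀ (by exact_mod_cast hL) hε]
      linarith
    have h3 : 1 ≤ 1 / ε := by rwa [le_div_iff₀ hε, one_mul]
    have h4 : 17 / ε = 16 / ε + 1 / ε := by ring
    push_cast
    linarith
  have h1 := sum_sum_ite_lt_le hF hreg hL σ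
  have h2 : ((#A / L + 1 : ℕ) : ℝ) * (ε ^ 2 / 68 * (#A * #B)) ≤ ε / 4 * (#A * #B) := by
    refine (mul_le_mul_of_nonneg_right hk (by positivity)).trans_eq ?_
    field_simp
    norm_num
  have h3 : 2 * (L : ℝ) * #B ≤ ε / 4 * (#A * #B) := by nlinarith
  have h4 : ∑ u ∈ A, ∑ v ∈ B, (f u v - rectAvg f A B) * orderSign σ u v =
      2 * ∑ u ∈ A, ∑ v ∈ B, (if σ u < σ v then f u v - rectAvg f A B else 0) -
        ∑ u ∈ A, ∑ v ∈ B, (f u v - rectAvg f A B) := by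
    simp only [mul_sum, ← sum_sub_distrib]
    refine sum_congr rfl fun u hu => sum_congr rfl fun v hv => ?_
    rw [orderSign_eq_of_ne σ (disjoint_iff_ne.1 hd u hu v hv)]
    split_ifs <;> ring
  rw [h4, sum_sum_sub_const, sum_sum_eq_mul_rectAvg f hAn hBn]
  linarith

end Staircase

section Bias

variable {n : ℕ} {P : Equiv.Perm (Fin n) → ℝ}

lemma mul_card_le_abs_expectedSign (hP : ∀ σ, 0 ≤ P σ) (hP1 : ∑ σ, P σ = 1)
    {f : Fin n → Fin n → ℝ} (hf : ∀ u v, |f u v| ≤ 1) {ε : ℝ}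
    (hb : ∀ u v, u ≠ v → 2 * ε ≤ f u v * ∑ σ, P σ * orderSign σ u v)
    {A B : Finset (Fin n)} (hd : Disjoint A B)
    (hreg : ∀ σ, ∑ u ∈ A, ∑ v ∈ B, (f u v - rectAvg f A B) * orderSign σ u v ≤
      ε * (#A * #B)) :
    ε * (#A * #B) ≤ |expectedSign P A B| := by
  have h1 : 2 * ε * (#A * #B) ≤ ∑ u ∈ A, ∑ v ∈ B, f u v * ∑ σ, P σ * orderSign σ u v := by
    calc _ = ∑ u ∈ A, ∑ v ∈ B, 2 * ε := by
          simp only [sum_const, nsmul_eq_mul]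
          ring
      _ ≤ _ := sum_le_sum fun u hu => sum_le_sum fun v hv =>
          hb u v (disjoint_iff_ne.1 hd u hu v hv)
  have h2 : ∑ u ∈ A, ∑ v ∈ B, f u v * ∑ σ, P σ * orderSign σ u v =
      ∑ σ, P σ * ∑ u ∈ A, ∑ v ∈ B, (f u v - rectAvg f A B) * orderSign σ u v +
        rectAvg f A B * expectedSign P A B := by
    rw [expectedSign]
    simp only [mul_sum]
    rw [← sum_add_distrib]
    simp only [← sum_add_distrib]
    conv_rhs => rw [sum_comm]
    refine sum_congr rfl fun u _ => ?_
    conv_rhs => rw [sum_comm]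
    refine sum_congr rfl fun v _ => sum_congr rfl fun σ _ => ?_
    ring
  have h3 : ∑ σ, P σ * ∑ u ∈ A, ∑ v ∈ B, (f u v - rectAvg f A B) * orderSign σ u v ≤
      ε * (#A * #B) := by
    calc _ ≤ ∑ σ, P σ * (ε * (#A * #B)) :=
          sum_le_sum fun σ _ => mul_le_mul_of_nonneg_left (hreg σ) (hP σ)
      _ = _ := by rw [← sum_mul, hP1, one_mul]
  have h4 : rectAvg f A B * expectedSign P A B ≤ |expectedSign P A B| := by
    refine (le_abs_self _).trans ?_
    rw [abs_mul]
    exact mul_le_of_le_one_left (abs_nonneg _) (abs_rectAvg_le_one hf A B)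
  linarith

/-- The first of the two sets can be replaced by a subset of prescribed size. -/
lemma exists_subset_mul_abs_expectedSign_le (P : Equiv.Perm (Fin n) → ℝ) (A B : Finset (Fin n))
    {k : ℕ} (hk : k ≤ #A) :
    ∃ A' ⊆ A, #A' = k ∧ k * |expectedSign P A B| ≤ #A * |expectedSign P A' B| := by
  have key : ∀ ς : ℝ, |ς| = 1 → |expectedSign P A B| = ς * expectedSign P A B →
      ∃ A' ⊆ A, #A' = k ∧ k * |expectedSign P A B| ≤ #A * |expectedSign P A' B| := by
    intro ς hς h
    obtain ⟨A', hA', hA'k, hsum⟩ := exists_subset_card_eq_mul_sum_le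
      (fun u => ς * ∑ v ∈ B, ∑ σ, P σ * orderSign σ u v) A hk
    refine ⟨A', hA', hA'k, ?_⟩
    rw [← mul_sum, ← mul_sum, ← expectedSign_eq, ← expectedSign_eq, ← h] at hsum
    refine hsum.trans (mul_le_mul_of_nonneg_left ?_ (by positivity))
    refine (le_abs_self _).trans_eq ?_
    rw [abs_mul, hς, one_mul]
  rcases abs_cases (expectedSign P A B) with ⟨h, _⟩ | ⟨h, _⟩
  · exact key 1 (by simp) (by rw [h, one_mul])
  · exact key (-1) (by simp) (by rw [h]; ring)

lemma exists_balanced_subsets {A B : Finset (Fin n)} (hA : A.Nonempty) (hB : B.Nonempty) {m : ℕ}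
    (hmA : m ≤ #A) (hmB : m ≤ #B) {ε : ℝ}
    (h : ε * (#A * #B) ≤ |expectedSign P A B|) :
    ∃ A' ⊆ A, ∃ B' ⊆ B, #A' = m ∧ #B' = m ∧ ε * m ^ 2 ≤ |expectedSign P A' B'| := by
  obtain ⟨A', hA', hA'm, h1⟩ := exists_subset_mul_abs_expectedSign_le P A B hmA
  obtain ⟨B', hB', hB'm, h2⟩ := exists_subset_mul_abs_expectedSign_le P B A' hmB
  refine ⟨A', hA', B', hB', hA'm, hB'm, ?_⟩
  rw [expectedSign_swap P B A', expectedSign_swap P B' A', abs_neg, abs_neg] at h2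
  have hApos : (0 : ℝ) < #A := by exact_mod_cast hA.card_pos
  have hBpos : (0 : ℝ) < #B := by exact_mod_cast hB.card_pos
  have hm : (0 : ℝ) ≤ m := by positivity
  refine le_of_mul_le_mul_left ?_ (mul_pos hApos hBpos)
  calc _ = m * (m * (ε * (#A * #B))) := by ring
    _ ≤ m * (m * |expectedSign P A B|) := by gcongr
    _ ≤ m * (#A * |expectedSign P A' B|) := by gcongr
    _ = #A * (m * |expectedSign P A' B|) := by ring
    _ ≤ #A * (#B * |expectedSign P A' B'|) := by gcongr
    _ = _ := by ring

/-- The guaranteed proportion of a set that is covered by each part of a biased pair. -/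
noncomputable def pairDensity (ε : ℝ) : ℝ := Real.exp (-2 / (ε ^ 2 / 68)) / 9

lemma pairDensity_pos (ε : ℝ) : 0 < pairDensity ε := by
  unfold pairDensity
  positivity

lemma exists_biased_pair (hP : ∀ σ, 0 ≤ P σ) (hP1 : ∑ σ, P σ = 1)
    {f : Fin n → Fin n → ℝ} (hf : ∀ u v, |f u v| ≤ 1) {ε : ℝ} (hε : 0 < ε) (hε1 : ε ≤ 1)
    (hb : ∀ u v, u ≠ v → 2 * ε ≤ f u v * ∑ σ, P σ * orderSign σ u v)
    {X : Finset (Fin n)} (hX2 : 2 ≤ #X) (hX : 8 ≤ ε * (pairDensity ε * #X)) :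
    ∃ A ⊆ X, ∃ B ⊆ X, Disjoint A B ∧ ∃ m : ℕ, 0 < m ∧ #A = m ∧ #B = m ∧
      pairDensity ε * #X ≤ m ∧ ε * m ^ 2 ≤ |expectedSign P A B| := by
  obtain ⟨A₀, hA₀, hA₀c⟩ := exists_subset_card_eq (show #X / 2 ≤ #X by lia)
  obtain ⟨B₀, hB₀, hB₀c⟩ := exists_subset_card_eq
    (show #X / 2 ≤ #(X \ A₀) by rw [card_sdiff_of_subset hA₀]; lia)
  have hd₀ : Disjoint A₀ B₀ := disjoint_of_subset_right hB₀ disjoint_sdiff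
  obtain ⟨A, hAX, B, hBX, hd, hA, hB, hsize, hreg⟩ := exists_upper_regular_pair hf
    (show 0 < ε ^ 2 / 68 by positivity) hA₀ (hB₀.trans sdiff_subset) hd₀
    (card_pos.1 (by lia)) (card_pos.1 (by lia))
  have hXpos : (0 : ℝ) < #X := by exact_mod_cast (show 0 < #X by lia)
  have hprod : pairDensity ε * #X * #X ≤ #A * #B := by
    refine le_trans ?_ hsize
    have h1 : (#X : ℝ) / 3 ≤ (#X / 2 : ℕ) := by
      have : (#X : ℝ) ≤ 3 * (#X / 2 : ℕ) := by exact_mod_cast (show #X ≤ 3 * (#X / 2) by lia)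
      linarith
    rw [hA₀c, hB₀c, pairDensity]
    calc _ = Real.exp (-2 / (ε ^ 2 / 68)) * (#X / 3 * (#X / 3)) := by ring
      _ ≤ _ := by gcongr
  have hAle : (#A : ℝ) ≤ #X := by exact_mod_cast card_le_card hAX
  have hBle : (#B : ℝ) ≤ #X := by exact_mod_cast card_le_card hBX
  have hAge : pairDensity ε * #X ≤ #A := by
    refine le_of_mul_le_mul_right (hprod.trans ?_) hXpos
    gcongr
  have hBge : pairDensity ε * #X ≤ #B := by
    refine le_of_mul_le_mul_right (hprod.trans ?_) hXpos
    rw [mul_comm]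
    gcongr
  have hbias := mul_card_le_abs_expectedSign hP hP1 hf hb hd
    (sum_sum_mul_orderSign_le hf hε hε1 hd hA hB (hX.trans (by gcongr)) hreg)
  obtain ⟨A', hA', B', hB', hA'm, hB'm, h⟩ :=
    exists_balanced_subsets hA hB (min_le_left _ _) (min_le_right _ _) hbias
  refine ⟨A', hA'.trans hAX, B', hB'.trans hBX,
    disjoint_of_subset_left hA' (disjoint_of_subset_right hB' hd), min #A #B,
    lt_min hA.card_pos hB.card_pos, hA'm, hB'm, ?_, h⟩
  rw [Nat.cast_min]
  exact le_min hAge hBge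

lemma sub_le_mul_log_sub {y w : ℝ} (hy : 0 ≤ y) (hw : 0 < w) :
    y - w ≤ y * Real.log y - y * Real.log w := by
  rcases hy.eq_or_lt with rfl | hy
  · simp [hw.le]
  · have h := Real.log_le_sub_one_of_pos (div_pos hw hy)
    rw [Real.log_div hw.ne' hy.ne'] at h
    have h1 := mul_le_mul_of_nonneg_left h hy.le
    have h2 : y * (w / y - 1) = w - y := by field_simp
    linarith

lemma mul_log_sub_mul_log_three_le {a b c : ℝ} (ha : 0 ≤ a) (hb : 0 ≤ b) (hc : 0 ≤ c)
    (h : 0 < a + b + c) :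
    (a + b + c) * Real.log (a + b + c) - (a + b + c) * Real.log 3 ≤
      a * Real.log a + b * Real.log b + c * Real.log c := by
  have hw : 0 < (a + b + c) / 3 := by positivity
  have h1 := sub_le_mul_log_sub ha hw
  have h2 := sub_le_mul_log_sub hb hw
  have h3 := sub_le_mul_log_sub hc hw
  rw [Real.log_div h.ne' (by norm_num)] at h1 h2 h3
  linarith

/-- The entropy deficit of `X` is of order `#X * log #X`. -/
lemma mul_log_le_entropySaving (hP : ∀ σ, 0 ≤ P σ) (hP1 : ∑ σ, P σ = 1)
    {f : Fin n → Fin n → ℝ} (hf : ∀ u v, |f u v| ≤ 1) {ε : ℝ} (hε : 0 < ε) (hε1 : ε ≤ 1)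
    (hb : ∀ u v, u ≠ v → 2 * ε ≤ f u v * ∑ σ, P σ * orderSign σ u v)
    {K : ℝ} (hK2 : 2 ≤ K) (hK : 8 ≤ ε * (pairDensity ε * K))
    (hKlog : ∀ m : ℕ, pairDensity ε * K ≤ m → Real.log (2 * m) ≤ ε ^ 2 / 8 * m)
    (X : Finset (Fin n)) :
    ε ^ 2 * pairDensity ε / 16 * (#X * Real.log #X - #X * Real.log K) ≤ entropySaving P X := by
  have hc := pairDensity_pos ε
  set γ := ε ^ 2 * pairDensity ε / 16 with hγdef
  have hγ : 0 < γ := by positivity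
  induction X using Finset.strongInduction with
  | H X ih =>
    rcases lt_or_ge (#X : ℝ) K with hXK | hXK
    · refine le_trans ?_ (entropySaving_nonneg hP hP1 X)
      refine mul_nonpos_of_nonneg_of_nonpos hγ.le ?_
      rcases Nat.eq_zero_or_pos #X with h0 | h0
      · simp [h0]
      · have h0' : (0 : ℝ) < #X := by exact_mod_cast h0
        rw [← mul_sub]
        exact mul_nonpos_of_nonneg_of_nonpos h0'.le
          (sub_nonpos.2 (Real.log_le_log h0' hXK.le))
    · obtain ⟨A, hA, B, hB, hd, m, hm, hAm, hBm, hXm, hE⟩ := exists_biased_pair hP hP1 hf hε hε1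
        hb (by exact_mod_cast hK2.trans hXK) (hK.trans (by gcongr))
      have hlog := hKlog m (le_trans (by gcongr) hXm)
      have hAB : A ∪ B ⊆ X := union_subset hA hB
      have h1 := add_entropySaving_of_abs_expectedSign hP hP1 hd hm hAm hBm hε hE
      have h2 := entropySaving_add_le hP hP1 (disjoint_sdiff : Disjoint (A ∪ B) (X \ (A ∪ B)))
      rw [union_sdiff_of_subset hAB] at h2
      have hcard : #X = #A + #B + #(X \ (A ∪ B)) := by
        rw [card_sdiff_of_subset hAB, ← card_union_of_disjoint hd]
        have := card_le_card hAB
        lia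
      have hlt : ∀ Y ⊆ X, #Y < #X → Y ⊂ X := fun Y hY h =>
        hY.ssubset_of_ne fun e => h.ne (by rw [e])
      have iA := ih A (hlt A hA (by lia))
      have iB := ih B (hlt B hB (by lia))
      have iC := ih (X \ (A ∪ B)) (hlt _ sdiff_subset (by lia))
      have hXpos : (0 : ℝ) < #X := by linarith
      have hcard' : (#X : ℝ) = #A + #B + #(X \ (A ∪ B)) := by exact_mod_cast hcard
      have h3 := mul_log_sub_mul_log_three_le (a := #A) (b := #B) (c := #(X \ (A ∪ B)))
        (by positivity) (by positivity) (by positivity) (by rwa [← hcard'])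
      rw [← hcard'] at h3
      have h4 := mul_le_mul_of_nonneg_left h3 hγ.le
      have h5 : (#X : ℝ) * Real.log K = #A * Real.log K + #B * Real.log K +
          #(X \ (A ∪ B)) * Real.log K := by
        rw [hcard']
        ring
      have h6 : γ * (#X * Real.log 3) ≤ ε ^ 2 / 8 * m := by
        have h7 : Real.log 3 ≤ 2 := by
          have := Real.log_le_sub_one_of_pos (show (0 : ℝ) < 3 by norm_num)
          linarith
        calc γ * (#X * Real.log 3) ≤ γ * (#X * 2) := by gcongr
          _ = ε ^ 2 / 8 * (pairDensity ε * #X) := by rw [hγdef]; ring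
          _ ≤ _ := by gcongr
      rw [h5]
      linarith

end Bias

lemma exists_log_two_mul_le {c : ℝ} (hc : 0 < c) :
    ∃ M : ℝ, ∀ m : ℕ, M ≤ m → Real.log (2 * m) ≤ c * m := by
  have h := (Real.isLittleO_log_id_atTop.bound (half_pos hc)).and (Filter.eventually_ge_atTop 0)
  obtain ⟨M, hM⟩ := Filter.eventually_atTop.1 h
  refine ⟨M, fun m hm => ?_⟩
  have h1 := hM (2 * m) (by have : (0 : ℝ) ≤ m := by positivity
                            linarith)
  rw [Real.norm_eq_abs, Real.norm_eq_abs, id, abs_of_nonneg h1.2] at h1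
  linarith [le_abs_self (Real.log (2 * m)), h1.1]

lemma log_factorial_le (n : ℕ) : Real.log n.factorial ≤ n * Real.log n := by
  rw [← Real.log_pow]
  refine Real.log_le_log (by positivity) ?_
  exact_mod_cast n.factorial_le_pow

lemma exists_log_factorial_le_entropySaving {ε : ℝ} (hε : 0 < ε) (hε1 : ε ≤ 1) :
    ∃ θ : ℝ, 0 < θ ∧ ∀ (n : ℕ) (P : Equiv.Perm (Fin n) → ℝ), (∀ σ, 0 ≤ P σ) → ∑ σ, P σ = 1 →
      ∀ f : Fin n → Fin n → ℝ, (∀ u v, |f u v| ≤ 1) →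
      (∀ u v, u ≠ v → 2 * ε ≤ f u v * ∑ σ, P σ * orderSign σ u v) →
      θ * Real.log n.factorial ≤ entropySaving P univ := by
  obtain ⟨M, hM⟩ := exists_log_two_mul_le (show 0 < ε ^ 2 / 8 by positivity)
  have hc := pairDensity_pos ε
  set K := max 2 (max (8 / (ε * pairDensity ε)) (M / pairDensity ε)) with hKdef
  have hK2 : 2 ≤ K := le_max_left _ _
  have hK8 : 8 ≤ ε * (pairDensity ε * K) := by
    have : 8 / (ε * pairDensity ε) ≤ K := (le_max_left _ _).trans (le_max_right _ _)
    rw [div_le_iff₀ (by positivity)] at this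
    linarith
  have hKM : M ≤ pairDensity ε * K := by
    have : M / pairDensity ε ≤ K := (le_max_right _ _).trans (le_max_right _ _)
    rw [div_le_iff₀ hc] at this
    linarith
  set N := ⌈K ^ 2⌉₊ with hNdef
  set F := Real.log N.factorial + 1
  have hF : 0 < F := by
    have : 0 ≤ Real.log N.factorial := Real.log_natCast_nonneg _
    positivity
  refine ⟨min (ε ^ 2 * pairDensity ε / 32) (2 * ε ^ 2 / F), by positivity,
    fun n P hP hP1 f hf hb => ?_⟩
  have hfac : 0 ≤ Real.log n.factorial := Real.log_natCast_nonneg _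
  rcases le_or_gt N n with hNn | hNn
  · have hKn : K ^ 2 ≤ n := (Nat.le_ceil _).trans (by exact_mod_cast hNn)
    have h1 := mul_log_le_entropySaving hP hP1 hf hε hε1 hb hK2 hK8
      (fun m hm => hM m (hKM.trans hm)) univ
    rw [card_univ, Fintype.card_fin] at h1
    have h2 := Real.log_le_log (by positivity) hKn
    rw [Real.log_pow] at h2
    push_cast at h2
    refine le_trans ?_ h1
    calc _ ≤ ε ^ 2 * pairDensity ε / 32 * Real.log n.factorial := by
          gcongr
          exact min_le_left _ _
      _ ≤ ε ^ 2 * pairDensity ε / 32 * (n * Real.log n) := by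
          gcongr
          exact log_factorial_le n
      _ = ε ^ 2 * pairDensity ε / 16 * (n * (Real.log n / 2)) := by ring
      _ ≤ ε ^ 2 * pairDensity ε / 16 * (n * (Real.log n - Real.log K)) := by
          gcongr
          linarith
      _ = _ := by ring
  · rcases lt_or_ge n 2 with hn | hn
    · have : n.factorial = 1 := Nat.factorial_eq_one.2 (by lia)
      simp only [this, Nat.cast_one, Real.log_one, mul_zero]
      exact entropySaving_nonneg hP hP1 _
    · have huv : (⟨0, by lia⟩ : Fin n) ≠ ⟨1, by lia⟩ := by simp
      have h1 : 2 * ε ≤ |∑ σ, P σ * orderSign σ ⟨0, by lia⟩ ⟨1, by lia⟩| := by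
        refine (hb _ _ huv).trans ((le_abs_self _).trans ?_)
        rw [abs_mul]
        exact mul_le_of_le_one_left (abs_nonneg _) (hf _ _)
      refine le_trans ?_ ((entropySaving_pair hP hP1 huv hε h1).trans
        (entropySaving_mono hP hP1 (subset_univ _)))
      have h2 : Real.log n.factorial ≤ F := by
        have : Real.log n.factorial ≤ Real.log N.factorial :=
          Real.log_le_log (by positivity) (by exact_mod_cast Nat.factorial_le hNn.le)
        linarith
      calc _ ≤ 2 * ε ^ 2 / F * F := by
            gcongr
            exact min_le_right _ _
        _ = _ := by field_simp

lemma sum_mul_orderSign_eq {n : ℕ} {P : Equiv.Perm (Fin n) → ℝ} (hP1 : ∑ σ, P σ = 1)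
    {u v : Fin n} (h : u ≠ v) :
    ∑ σ, P σ * orderSign σ u v =
      2 * ∑ σ ∈ univ.filter (fun σ : Equiv.Perm (Fin n) => σ u < σ v), P σ - 1 := by
  have h1 : ∀ σ, P σ * orderSign σ u v = 2 * (if σ u < σ v then P σ else 0) - P σ := by
    intro σ
    rw [orderSign_eq_of_ne σ h]
    split_ifs <;> ring
  simp only [h1, sum_sub_distrib, ← mul_sum, hP1, sum_filter]


/-- **Leighton–Moitra conjecture (Kahn et al.).**
For every real `ε ∈ (0, 1/2)` there exists `θ > 0` such that for every positive `n`,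
every tournament `T` on `[n]` and every probability distribution `P` on the permutations
of `[n]` satisfying `P(σ u < σ v) > 1/2 + ε` for every arc `uv` of `T`, the binary
entropy of `P` is at most `(1 - θ) · log₂ (n!)`. -/
theorem entropy_of_tournament_agreeing_distribution
    (ε : ℝ) (hε0 : 0 < ε) (hε1 : ε < 1 / 2) :
    ∃ θ : ℝ, 0 < θ ∧
      ∀ (n : ℕ), 0 < n →
      ∀ (T : Fin n → Fin n → Prop),
        (∀ u, ¬ T u u) →
        (∀ u v : Fin n, u ≠ v → (T u v ↔ ¬ T v u)) →
      ∀ (P : Equiv.Perm (Fin n) → ℝ),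
        (∀ σ, 0 ≤ P σ) →
        (∑ σ : Equiv.Perm (Fin n), P σ) = 1 →
        (∀ u v : Fin n, T u v →
          1 / 2 + ε < ∑ σ ∈ Finset.univ.filter (fun σ : Equiv.Perm (Fin n) => σ u < σ v), P σ) →
        (- ∑ σ : Equiv.Perm (Fin n), P σ * Real.logb 2 (P σ)) ≤
          (1 - θ) * Real.logb 2 (Nat.factorial n) := by
  classical
  obtain ⟨θ, hθ, h⟩ := exists_log_factorial_le_entropySaving hε0 (by linarith)
  refine ⟨θ, hθ, fun n _ T _ hT P hP hP1 hbias => ?_⟩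
  have h1 := h n P hP hP1 (fun u v => if T u v then 1 else -1)
    (fun u v => by split_ifs <;> simp) (by
      intro u v huv
      split_ifs with huvT
      · rw [sum_mul_orderSign_eq hP1 huv]
        linarith [hbias u v huvT]
      · have hvuT := (hT v u huv.symm).2 huvT
        simp only [orderSign_antisymm _ u v, mul_neg, sum_neg_distrib]
        rw [sum_mul_orderSign_eq hP1 huv.symm]
        linarith [hbias v u hvuT])
  have h2 := varEntropy_le_of_determines hP (orderOn univ) id
    fun σ τ hst => orderOn_univ_injective hst
  have h3 : varEntropy P id = -∑ σ, P σ * Real.log (P σ) := by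
    simp [varEntropy, fiberProb, filter_eq']
  have h4 : (-∑ σ : Equiv.Perm (Fin n), P σ * Real.logb 2 (P σ)) =
      (-∑ σ, P σ * Real.log (P σ)) / Real.log 2 := by
    simp only [Real.logb, neg_div, sum_div, mul_div_assoc]
  rw [h4, Real.logb, ← mul_div_assoc]
  refine div_le_div_of_nonneg_right ?_ (Real.log_nonneg (by norm_num))
  rw [entropySaving, card_univ, Fintype.card_fin] at h1
  linarith
end

section
/- Let ε ∈ (0, 1/2), let n be a positive integer, and let P be a probability distribution on the set S_n of permutations of [n] such that for all 1 ≤ u < v ≤ n one has P({σ ∈ S_n : σ(u) < σ(v)}) > 1/2 + ε. Then the binary entropy of P satisfies H(P) ≤ (1 − ε²/8)·n·log₂ n. -/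
lemma cross_entropy_term_le {x y : ℝ} (hx0 : 0 ≤ x) (hx1 : x ≤ 1) (hy0 : 0 < y) (hy1 : y ≤ 1) :
    x * Real.log y + Real.negMulLog x ≤ y - x - (x - y) ^ 2 / 4 := by
  have hs0 := Real.sqrt_nonneg x
  have ht0 := Real.sqrt_pos.2 hy0
  have hs1 : √x ≤ 1 := Real.sqrt_le_one.2 hx1
  have ht1 : √y ≤ 1 := Real.sqrt_le_one.2 hy1
  have hs := Real.sq_sqrt hx0
  have ht := Real.sq_sqrt hy0.le
  set s := √x
  set t := √y
  have hquad : (x - y) ^ 2 / 4 ≤ (s - t) ^ 2 := by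
    have h2 : (s + t) ^ 2 ≤ 4 := by nlinarith
    have : (x - y) ^ 2 = (s - t) ^ 2 * (s + t) ^ 2 := by rw [← hs, ← ht]; ring
    nlinarith [sq_nonneg (s - t)]
  suffices h : x * Real.log y + Real.negMulLog x ≤ y - x - (s - t) ^ 2 by linarith
  rcases hs0.eq_or_lt with h0 | h0
  · have : x = 0 := by rw [← hs, ← h0]; norm_num
    rw [this, ← h0, ← ht]; simp
  · have hlog := Real.log_le_sub_one_of_pos (div_pos ht0 h0)
    rw [Real.log_div ht0.ne' h0.ne'] at hlog
    rw [Real.negMulLog, ← hs, ← ht, Real.log_pow, Real.log_pow]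
    have hmul := mul_le_mul_of_nonneg_left hlog (sq_nonneg s)
    have : s ^ 2 * (t / s - 1) = s * t - s ^ 2 := by field_simp
    push_cast
    nlinarith

lemma binEntropy_le_cross_entropy_sub {m q : ℝ} (hm0 : 0 ≤ m) (hm1 : m ≤ 1)
    (hq0 : 0 < q) (hq1 : q < 1) :
    Real.binEntropy m ≤
      -(m * Real.log q + (1 - m) * Real.log (1 - q)) - (m - q) ^ 2 / 2 := by
  rw [Real.binEntropy_eq_negMulLog_add_negMulLog_one_sub]
  have h1 := cross_entropy_term_le hm0 hm1 hq0 hq1.le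
  have h2 := cross_entropy_term_le (x := 1 - m) (y := 1 - q) (by linarith) (by linarith)
    (by linarith) (by linarith)
  nlinarith

lemma sum_range_sub_sq (n : ℕ) (c : ℝ) :
    ∑ i ∈ Finset.range n, ((i : ℝ) - c) ^ 2 =
      n * c ^ 2 - c * (n * (n - 1)) + n * (n - 1) * (2 * n - 1) / 6 := by
  induction n with
  | zero => simp
  | succ n ih => rw [Finset.sum_range_succ, ih]; push_cast; ring

lemma sum_range_cast (n : ℕ) : ∑ i ∈ Finset.range n, (i : ℝ) = n * (n - 1) / 2 := by
  induction n with
  | zero => simp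
  | succ n ih => rw [Finset.sum_range_succ, ih]; push_cast; ring

lemma sum_binEntropy_le {ε : ℝ} (hε : 0 ≤ ε) {a b n : ℕ} (ha : 0 < a) (hb : 0 < b)
    (hab : a + b = n) (hbal : 2 * (n : ℝ) ^ 2 ≤ 9 * (a * b)) {m : ℕ → ℝ}
    (hm0 : ∀ i, 0 ≤ m i) (hm1 : ∀ i, m i ≤ 1) (hsum : ∑ i ∈ Finset.range n, m i = b)
    (hrank : (b : ℝ) * (b - 1) / 2 + (1 / 2 + ε) * (a * b) ≤ ∑ i ∈ Finset.range n, i * m i) :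
    ∑ i ∈ Finset.range n, Real.binEntropy (m i) ≤
      (1 - ε ^ 2 / 8) * (n * Real.log n - a * Real.log a - b * Real.log b) := by
  have ha' : (0 : ℝ) < a := by exact_mod_cast ha
  have hb' : (0 : ℝ) < b := by exact_mod_cast hb
  have hn : (n : ℝ) = a + b := by rw [← hab]; push_cast; ring
  have hn' : (0 : ℝ) < n := by linarith
  set q : ℝ := b / n with hq
  have hq0 : 0 < q := by positivity
  have hq' : 1 - q = a / n := by rw [hq, hn]; field_simp; ring
  have hq1 : q < 1 := by have : 0 < 1 - q := by rw [hq']; positivity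
                         linarith
  have hnq : n * q = b := by rw [hq]; field_simp
  set E : ℝ := n * Real.log n - a * Real.log a - b * Real.log b with hE
  have hcross : ∑ i ∈ Finset.range n, (m i * Real.log q + (1 - m i) * Real.log (1 - q)) = -E := by
    rw [Finset.sum_add_distrib, ← Finset.sum_mul, ← Finset.sum_mul, Finset.sum_sub_distrib, hsum,
      hq', hq, Real.log_div hb'.ne' hn'.ne', Real.log_div ha'.ne' hn'.ne', hE]
    simp only [Finset.sum_const, Finset.card_range, nsmul_eq_mul, mul_one]
    rw [hn]; ring
  have hEle : E ≤ n * Real.log 2 := by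
    have h := Real.binEntropy_le_log_two (p := q)
    have : n * Real.binEntropy q = E := by
      rw [Real.binEntropy_eq_negMulLog_add_negMulLog_one_sub, Real.negMulLog, Real.negMulLog, hq',
        hq, Real.log_div hb'.ne' hn'.ne', Real.log_div ha'.ne' hn'.ne', hE]
      field_simp
      rw [hn]; ring
    rw [← this]
    gcongr
  set V := ∑ i ∈ Finset.range n, (m i - q) ^ 2 with hV
  have hle : ∑ i ∈ Finset.range n, Real.binEntropy (m i) ≤ E - V / 2 := by
    calc _ ≤ ∑ i ∈ Finset.range n,
          (-(m i * Real.log q + (1 - m i) * Real.log (1 - q)) - (m i - q) ^ 2 / 2) :=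
          Finset.sum_le_sum fun i _ =>
            binEntropy_le_cross_entropy_sub (hm0 i) (hm1 i) hq0 hq1
      _ = _ := by
          rw [Finset.sum_sub_distrib, Finset.sum_neg_distrib, hcross, ← Finset.sum_div]; ring
  have hcov : ε * (a * b) ≤ ∑ i ∈ Finset.range n, (m i - q) * (i - (n - 1) / 2 : ℝ) := by
    have : ∑ i ∈ Finset.range n, (m i - q) * (i - (n - 1) / 2 : ℝ) =
        ∑ i ∈ Finset.range n, i * m i - (n - 1) / 2 * ∑ i ∈ Finset.range n, m i
          - q * ∑ i ∈ Finset.range n, (i : ℝ) + n * (q * ((n - 1) / 2)) := by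
      rw [Finset.mul_sum, Finset.mul_sum, ← Finset.sum_sub_distrib, ← Finset.sum_sub_distrib]
      have : (n : ℝ) * (q * ((n - 1) / 2)) =
          ∑ i ∈ Finset.range n, (q * (((n : ℝ) - 1) / 2)) := by simp
      rw [this, ← Finset.sum_add_distrib]
      exact Finset.sum_congr rfl fun i _ => by ring
    rw [this, hsum, sum_range_cast]
    have h3 : q * (n * (n - 1) / 2) = b * (n - 1) / 2 := by rw [← hnq]; ring
    have h4 : n * (q * (((n : ℝ) - 1) / 2)) = b * (n - 1) / 2 := by rw [← hnq]; ring
    rw [h3, h4]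
    have h5 : ((n : ℝ) - 1) / 2 * b = b * (b - 1) / 2 + a * b / 2 := by rw [hn]; ring
    rw [h5]
    linarith
  have hcs := Finset.sum_mul_sq_le_sq_mul_sq (Finset.range n) (fun i => m i - q)
    (fun i => (i - (n - 1) / 2 : ℝ))
  rw [sum_range_sub_sq, ← hV] at hcs
  have hV0 : 0 ≤ V := Finset.sum_nonneg fun i _ => sq_nonneg _
  have hsq : (ε * (a * b)) ^ 2 ≤ V * (n ^ 3 / 12) := by
    have h1 : (ε * (a * b)) ^ 2 ≤
      (∑ i ∈ Finset.range n, (m i - q) * (i - (n - 1) / 2 : ℝ)) ^ 2 := by gcongr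
    refine (h1.trans hcs).trans ?_
    gcongr
    nlinarith
  have hgain : ε ^ 2 * n / 4 ≤ V / 2 := by
    have h1 : (2 * (n : ℝ) ^ 2 / 9) ^ 2 ≤ (a * b) ^ 2 := by gcongr; linarith
    have h2 : ε ^ 2 * (2 * (n : ℝ) ^ 2 / 9) ^ 2 ≤ V * (n ^ 3 / 12) := by
      refine le_trans ?_ hsq
      rw [mul_pow]; gcongr
    have h3 : (ε ^ 2 * n * (48 / 81)) * n ^ 3 ≤ V * n ^ 3 := by nlinarith
    have h4 := le_of_mul_le_mul_right h3 (by positivity)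
    have : 0 ≤ ε ^ 2 * n := by positivity
    linarith
  have hlog2 := Real.log_two_lt_d9
  have : ε ^ 2 / 8 * E ≤ ε ^ 2 * n / 4 := by
    calc _ ≤ ε ^ 2 / 8 * (n * 1) := by
          gcongr
          exact hEle.trans (by gcongr; linarith)
      _ ≤ _ := by have : 0 ≤ ε ^ 2 * n := by positivity
                  linarith
  linarith

lemma exists_product_code {Ω : Type*} [Fintype Ω] {w : Ω → ℝ} (hw0 : ∀ ω, 0 ≤ w ω)
    (hw1 : ∑ ω, w ω = 1) {n : ℕ} (B : Ω → Fin n → Bool) :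
    ∃ Q : (Fin n → Bool) → ℝ, (∀ f, 0 ≤ Q f) ∧ ∑ f, Q f = 1 ∧ (∀ ω, 0 < w ω → 0 < Q (B ω)) ∧
      ∑ ω, w ω * -Real.log (Q (B ω)) =
        ∑ i, Real.binEntropy (∑ ω, if B ω i then w ω else 0) := by
  set m : Fin n → ℝ := fun i => ∑ ω, if B ω i then w ω else 0 with hm
  have hcompl : ∀ i, 1 - m i = ∑ ω, if B ω i then 0 else w ω := fun i => by
    rw [← hw1, hm, ← Finset.sum_sub_distrib]
    exact Finset.sum_congr rfl fun ω _ => by split_ifs <;> simp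
  set c : Fin n → Bool → ℝ := fun i b => if b then m i else 1 - m i with hc
  have hc0 : ∀ i b, 0 ≤ c i b := fun i b => by
    cases b
    · simp only [hc, Bool.false_eq_true, if_false, hcompl]
      exact Finset.sum_nonneg fun ω _ => by split_ifs <;> simp [hw0]
    · simp only [hc, if_true, hm]
      exact Finset.sum_nonneg fun ω _ => by split_ifs <;> simp [hw0]
  have hcpos : ∀ ω, 0 < w ω → ∀ i, 0 < c i (B ω i) := fun ω hω i => by
    cases h : B ω i
    · simp only [hc, Bool.false_eq_true, if_false, hcompl]
      refine Finset.sum_pos' (fun ω' _ => ?_) ⟨ω, Finset.mem_univ ω, by simpa [h] using hω⟩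
      split_ifs <;> simp [hw0]
    · simp only [hc, if_true, hm]
      refine Finset.sum_pos' (fun ω' _ => ?_) ⟨ω, Finset.mem_univ ω, by simpa [h] using hω⟩
      split_ifs <;> simp [hw0]
  refine ⟨fun f => ∏ i, c i (f i), fun f => Finset.prod_nonneg fun i _ => hc0 i _, ?_,
    fun ω hω => Finset.prod_pos fun i _ => hcpos ω hω i, ?_⟩
  · rw [← Fintype.piFinset_univ, ← Finset.prod_univ_sum]
    simp [hc]
  · have hlog : ∀ ω, w ω * -Real.log (∏ i, c i (B ω i)) =
        ∑ i, w ω * -Real.log (c i (B ω i)) := fun ω => by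
      rcases (hw0 ω).eq_or_lt with h | h
      · simp [← h]
      · rw [Real.log_prod fun i _ => (hcpos ω h i).ne', ← Finset.sum_neg_distrib,
          Finset.mul_sum]
    rw [Finset.sum_congr rfl fun ω _ => hlog ω, Finset.sum_comm]
    refine Finset.sum_congr rfl fun i _ => ?_
    rw [Real.binEntropy, Real.log_inv, Real.log_inv, hcompl i]
    change _ = m i * _ + _
    rw [← hcompl i]
    have h1 : m i * -Real.log (m i) =
        ∑ ω, (if B ω i then w ω else 0) * -Real.log (m i) := by rw [← Finset.sum_mul]
    have h2 : (1 - m i) * -Real.log (1 - m i) =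
        ∑ ω, (if B ω i then 0 else w ω) * -Real.log (1 - m i) := by
      rw [← Finset.sum_mul, ← hcompl]
    rw [h1, h2, ← Finset.sum_add_distrib]
    refine Finset.sum_congr rfl fun ω _ => ?_
    simp only [hc]
    split_ifs <;> simp

/-- Whether the entry of `l` at position `i` satisfies `p`; `false` beyond the end of `l`. -/
def mark {α : Type*} (p : α → Bool) (l : List α) (i : ℕ) : Bool := (l.map p).getD i false

lemma ite_mark_cons_succ {α : Type*} (p : α → Bool) (x : α) (l : List α) (i : ℕ) :
    (if mark p (x :: l) (i + 1) then (1 : ℝ) else 0) = if mark p l i then 1 else 0 := rfl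

lemma eq_of_filter_eq_of_map_eq {α : Type*} (p : α → Bool) :
    ∀ {l l' : List α}, l.filter p = l'.filter p →
      l.filter (fun x => !p x) = l'.filter (fun x => !p x) → l.map p = l'.map p → l = l'
  | [], [], _, _, _ => rfl
  | [], _ :: _, _, _, h => by simp at h
  | _ :: _, [], _, _, h => by simp at h
  | x :: l, y :: l', h1, h2, h3 => by
      simp only [List.map_cons, List.cons.injEq] at h3
      obtain ⟨hxy, h3⟩ := h3
      cases hx : p x
      · have hy : p y = false := by rw [← hxy, hx]
        simp only [List.filter_cons, hx, hy, Bool.not_false, if_true, List.cons.injEq,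
          Bool.false_eq_true, if_false] at h1 h2
        rw [h2.1, eq_of_filter_eq_of_map_eq p h1 h2.2 h3]
      · have hy : p y = true := by rw [← hxy, hx]
        simp only [List.filter_cons, hx, hy, Bool.not_true, if_true, List.cons.injEq,
          Bool.false_eq_true, if_false] at h1 h2
        rw [h1.1, eq_of_filter_eq_of_map_eq p h1.2 h2 h3]

lemma map_eq_of_mark_eq {α : Type*} {p : α → Bool} {l l' : List α} {n : ℕ}
    (hl : l.length = n) (hl' : l'.length = n)
    (h : (fun i : Fin n => mark p l i) = fun i : Fin n => mark p l' i) : l.map p = l'.map p := by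
  refine List.ext_getElem (by simp [hl, hl']) fun i h1 h2 => ?_
  have hi : i < n := by simpa [hl] using h1
  have := congrFun h ⟨i, hi⟩
  simpa only [mark, List.getD_eq_getElem _ _ h1, List.getD_eq_getElem _ _ h2] using this

lemma sum_mark {α : Type*} (p : α → Bool) (l : List α) :
    ∑ i ∈ Finset.range l.length, (if mark p l i then (1 : ℝ) else 0) = l.countP p := by
  induction l with
  | nil => simp
  | cons x l ih =>
    rw [List.length_cons, Finset.sum_range_succ', List.countP_cons]
    simp only [ite_mark_cons_succ, ih]
    push_cast
    rfl

lemma card_filter_mem_le_countP {α : Type*} [DecidableEq α] {p : α → Bool} {R : Finset α}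
    (hR : ∀ v ∈ R, p v = true) (l : List α) :
    (∑ v ∈ R, if v ∈ l then (1 : ℝ) else 0) ≤ l.countP p := by
  rw [Finset.sum_boole]
  norm_cast
  rw [List.countP_eq_length_filter]
  refine (Finset.card_le_card (t := (l.filter p).toFinset) fun v hv => ?_).trans
    (List.toFinset_card_le _)
  simp only [Finset.mem_filter] at hv
  simp [hv.2, hR v hv.1]

/-- Counting the agreeing pairs by the positions of the marked entries. -/
lemma agreeing_pairs_le_sum_positions {α : Type*} [DecidableEq α] {p : α → Bool} {L R : Finset α}
    (hL : ∀ u ∈ L, p u = false) (hR : ∀ v ∈ R, p v = true) (l : List α) :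
    (l.countP p : ℝ) * (l.countP p - 1) / 2 +
        ∑ u ∈ L, ∑ v ∈ R, (if [u, v].Sublist l then (1 : ℝ) else 0) ≤
      ∑ i ∈ Finset.range l.length, i * (if mark p l i then (1 : ℝ) else 0) := by
  induction l with
  | nil => simp
  | cons x l ih =>
    have hstep : ∑ i ∈ Finset.range (x :: l).length,
          i * (if mark p (x :: l) i then (1 : ℝ) else 0) =
        ∑ i ∈ Finset.range l.length, i * (if mark p l i then (1 : ℝ) else 0) +
          l.countP p := by
      rw [List.length_cons, Finset.sum_range_succ', ← sum_mark, ← Finset.sum_add_distrib]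
      simp only [ite_mark_cons_succ, Nat.cast_succ, Nat.cast_zero, zero_mul, add_zero, add_mul,
        one_mul]
    have hpair : ∀ u v, (if [u, v].Sublist (x :: l) then (1 : ℝ) else 0) ≤
        (if [u, v].Sublist l then 1 else 0) + if u = x then (if v ∈ l then 1 else 0) else 0 := by
      intro u v
      by_cases h1 : [u, v].Sublist l
      · rw [if_pos h1, if_pos (h1.cons x)]
        split_ifs <;> norm_num
      · by_cases h2 : u = x ∧ v ∈ l
        · rw [if_pos h2.1, if_pos h2.2]
          split_ifs <;> norm_num
        · have h3 : ¬ [u, v].Sublist (x :: l) := fun h => by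
            rcases List.sublist_cons_iff.1 h with h | ⟨r, hr, hs⟩
            · exact h1 h
            · simp only [List.cons.injEq] at hr
              exact h2 ⟨hr.1, by simpa [← hr.2] using hs⟩
          rw [if_neg h3, if_neg h1]
          split_ifs <;> norm_num
    have hsum : ∑ u ∈ L, ∑ v ∈ R, (if [u, v].Sublist (x :: l) then (1 : ℝ) else 0) ≤
        ∑ u ∈ L, ∑ v ∈ R, (if [u, v].Sublist l then (1 : ℝ) else 0) +
          if x ∈ L then ∑ v ∈ R, (if v ∈ l then (1 : ℝ) else 0) else 0 := by
      refine (Finset.sum_le_sum fun u _ => Finset.sum_le_sum fun v _ => hpair u v).trans ?_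
      simp only [Finset.sum_add_distrib]
      gcongr
      rw [← Finset.sum_ite_eq' L x fun _ => ∑ v ∈ R, if v ∈ l then (1 : ℝ) else 0]
      refine Finset.sum_le_sum fun u _ => ?_
      split_ifs <;> simp
    rw [hstep, List.countP_cons]
    cases hx : p x
    · have := card_filter_mem_le_countP hR l
      have h0 : (0 : ℝ) ≤ l.countP p := by positivity
      have : (if x ∈ L then ∑ v ∈ R, (if v ∈ l then (1 : ℝ) else 0) else 0) ≤ l.countP p := by
        split_ifs <;> assumption
      simp only [Bool.false_eq_true, if_false, add_zero]
      linarith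
    · have hxL : x ∉ L := fun h => by simp [hL x h] at hx
      rw [if_neg hxL] at hsum
      simp only [if_true]
      push_cast
      linarith

lemma exists_lower_subset {α : Type*} [LinearOrder α] (I : Finset α) {k : ℕ} (hk : k ≤ I.card) :
    ∃ L ⊆ I, L.card = k ∧ ∀ u ∈ L, ∀ v ∈ I \ L, u < v := by
  induction k with
  | zero => exact ⟨∅, by simp⟩
  | succ k ih =>
    obtain ⟨L, hLI, hLk, hL⟩ := ih (by omega)
    have hne : (I \ L).Nonempty := by
      rw [← Finset.card_pos, Finset.card_sdiff_of_subset hLI]; omega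
    set x := (I \ L).min' hne
    have hx : x ∈ I \ L := Finset.min'_mem _ _
    have hx' := Finset.mem_sdiff.1 hx
    refine ⟨insert x L, Finset.insert_subset hx'.1 hLI, by
      rw [Finset.card_insert_of_notMem hx'.2, hLk], fun u hu v hv => ?_⟩
    simp only [Finset.mem_sdiff, Finset.mem_insert, not_or] at hv
    have hv' : v ∈ I \ L := Finset.mem_sdiff.2 ⟨hv.1, hv.2.2⟩
    rcases Finset.mem_insert.1 hu with rfl | hu
    · exact lt_of_le_of_ne (Finset.min'_le _ _ hv') (Ne.symm hv.2.1)
    · exact hL u hu v hv'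

/-- A random ordering of `I`, given as a list, which agrees with each pair `u < v` with
probability at least `1/2 + ε`, has a code (a subprobability `Q` on orderings) of short expected
length. -/
lemma exists_ordering_code {α Ω : Type*} [LinearOrder α] [Fintype Ω] {w : Ω → ℝ}
    (hw0 : ∀ ω, 0 ≤ w ω) (hw1 : ∑ ω, w ω = 1) {ε : ℝ} (hε : 0 ≤ ε) (I : Finset α)
    (X : Ω → List α) (hX : ∀ ω, (X ω).Nodup ∧ (X ω).toFinset = I)
    (harc : ∀ u ∈ I, ∀ v ∈ I, u < v →
      1 / 2 + ε ≤ ∑ ω, if [u, v].Sublist (X ω) then w ω else 0) :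
    ∃ Q : List α → ℝ, (∀ l, 0 ≤ Q l) ∧
      (∀ T : Finset (List α), (∀ l ∈ T, l.Nodup ∧ l.toFinset = I) → ∑ l ∈ T, Q l ≤ 1) ∧
      (∀ ω, 0 < w ω → 0 < Q (X ω)) ∧
      ∑ ω, w ω * -Real.log (Q (X ω)) ≤ (1 - ε ^ 2 / 8) * (I.card * Real.log I.card) := by
  induction hn : I.card using Nat.strong_induction_on generalizing I X with
  | _ n ih =>
  have hlen : ∀ l : List α, l.Nodup ∧ l.toFinset = I → l.length = n := fun l hl => by
    rw [← hn, ← hl.2, List.toFinset_card_of_nodup hl.1]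
  rcases lt_or_ge n 2 with hn2 | hn2
  · refine ⟨fun _ => 1, fun _ => zero_le_one, fun T hT => ?_, fun _ _ => zero_lt_one, ?_⟩
    · have : T.card ≤ 1 := Finset.card_le_one.2 fun l hl l' hl' => by
        have h := (List.toFinset_eq_iff_perm_dedup.1 ((hT l hl).2.trans (hT l' hl').2.symm))
        rw [(hT l hl).1.dedup, (hT l' hl').1.dedup] at h
        have h1 := hlen l (hT l hl)
        match l, h1, h with
        | [], _, h => exact (List.nil_perm.1 h).symm
        | [x], _, h => exact (List.singleton_perm.1 h)
        | _ :: _ :: _, h1, _ => simp at h1; omega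
      simpa using this
    · have : n = 0 ∨ n = 1 := by omega
      rcases this with rfl | rfl <;> simp
  have ha : n - n / 2 < n := by omega
  have hb : n / 2 < n := by omega
  obtain ⟨L, hLI, hLa, hLR⟩ := exists_lower_subset I (k := n - n / 2) (by omega)
  set R := I \ L with hR
  have hRI : R ⊆ I := Finset.sdiff_subset
  have hRb : R.card = n / 2 := by rw [hR, Finset.card_sdiff_of_subset hLI]; omega
  set p : α → Bool := fun x => decide (x ∈ R) with hp
  have hpL : ∀ u ∈ L, p u = false := fun u hu => by simp [hp, hR, hu]
  have hpR : ∀ v ∈ R, p v = true := fun v hv => by simp [hp, hv]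
  have hfL : ∀ l : List α, l.Nodup ∧ l.toFinset = I →
      (l.filter fun x => !p x).Nodup ∧ (l.filter fun x => !p x).toFinset = L := fun l hl => by
    refine ⟨hl.1.filter _, ?_⟩
    ext x
    have hx : x ∈ l ↔ x ∈ I := by rw [← hl.2, List.mem_toFinset]
    have := @hLI x
    simp only [List.mem_toFinset, List.mem_filter, hx, hp, hR, Finset.mem_sdiff]
    by_cases x ∈ L <;> simp_all
  have hfR : ∀ l : List α, l.Nodup ∧ l.toFinset = I →
      (l.filter p).Nodup ∧ (l.filter p).toFinset = R := fun l hl => by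
    refine ⟨hl.1.filter _, ?_⟩
    ext x
    have hx : x ∈ l ↔ x ∈ I := by rw [← hl.2, List.mem_toFinset]
    have := @hRI x
    simp only [List.mem_toFinset, List.mem_filter, hx, hp, decide_eq_true_eq]
    tauto
  have hfilter : ∀ (q : α → Bool) (u v : α), q u = true → q v = true → ∀ l : List α,
      [u, v].Sublist l → [u, v].Sublist (l.filter q) := fun q u v hu hv l h => by
    simpa [hu, hv] using h.filter q
  have harc' : ∀ (q : α → Bool) (J : Finset α), J ⊆ I → (∀ u ∈ J, q u = true) →
      ∀ u ∈ J, ∀ v ∈ J, u < v →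
        1 / 2 + ε ≤ ∑ ω, if [u, v].Sublist ((X ω).filter q) then w ω else 0 := by
    intro q J hJ hq u hu v hv huv
    refine (harc u (hJ hu) v (hJ hv) huv).trans (Finset.sum_le_sum fun ω _ => ?_)
    by_cases h : [u, v].Sublist (X ω)
    · rw [if_pos h, if_pos (hfilter q u v (hq u hu) (hq v hv) _ h)]
    · rw [if_neg h]; split_ifs <;> simp [hw0]
  obtain ⟨QL, hQL0, hQLK, hQLpos, hQLE⟩ := ih _ ha L (fun ω => (X ω).filter fun x => !p x)
    (fun ω => hfL _ (hX ω)) (harc' _ L hLI fun u hu => by simp [hpL u hu]) hLa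
  obtain ⟨QR, hQR0, hQRK, hQRpos, hQRE⟩ := ih _ hb R (fun ω => (X ω).filter p)
    (fun ω => hfR _ (hX ω)) (harc' _ R hRI hpR) hRb
  obtain ⟨QM, hQM0, hQMK, hQMpos, hQME⟩ := exists_product_code hw0 hw1
    (n := n) (fun ω i => mark p (X ω) i)
  refine ⟨fun l => QL (l.filter fun x => !p x) * QR (l.filter p) * QM fun i => mark p l i,
    fun l => mul_nonneg (mul_nonneg (hQL0 _) (hQR0 _)) (hQM0 _), fun T hT => ?_,
    fun ω hω => mul_pos (mul_pos (hQLpos ω hω) (hQRpos ω hω)) (hQMpos ω hω), ?_⟩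
  · set φ : List α → (List α × List α) × (Fin n → Bool) :=
      fun l => ((l.filter fun x => !p x, l.filter p), fun i => mark p l i) with hφ
    have hinj : Set.InjOn φ T := fun l hl l' hl' h => by
      simp only [hφ, Prod.mk.injEq] at h
      exact eq_of_filter_eq_of_map_eq p h.1.2 h.1.1
        (map_eq_of_mark_eq (hlen l (hT l hl)) (hlen l' (hT l' hl')) h.2)
    set TL := T.image fun l => l.filter fun x => !p x
    set TR := T.image fun l => l.filter p
    calc _ = ∑ x ∈ T.image φ, QL x.1.1 * QR x.1.2 * QM x.2 := (Finset.sum_image hinj).symm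
      _ ≤ ∑ x ∈ (TL ×ˢ TR) ×ˢ Finset.univ, QL x.1.1 * QR x.1.2 * QM x.2 := by
          refine Finset.sum_le_sum_of_subset_of_nonneg ?_ fun x _ _ =>
            mul_nonneg (mul_nonneg (hQL0 _) (hQR0 _)) (hQM0 _)
          refine Finset.image_subset_iff.2 fun l hl => ?_
          simp only [Finset.mem_product, Finset.mem_univ, and_true]
          exact ⟨Finset.mem_image_of_mem _ hl, Finset.mem_image_of_mem _ hl⟩
      _ = (∑ l ∈ TL, QL l) * (∑ l ∈ TR, QR l) * ∑ f, QM f := by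
          rw [Finset.sum_mul_sum, ← Finset.sum_product', Finset.sum_mul_sum,
            ← Finset.sum_product']
      _ ≤ 1 * 1 * 1 := by
          rw [hQMK]
          gcongr
          · exact Finset.sum_nonneg fun l _ => hQR0 l
          · refine hQLK _ fun l hl => ?_
            obtain ⟨l', hl', rfl⟩ := Finset.mem_image.1 hl
            exact hfL _ (hT l' hl')
          · refine hQRK _ fun l hl => ?_
            obtain ⟨l', hl', rfl⟩ := Finset.mem_image.1 hl
            exact hfR _ (hT l' hl')
      _ = 1 := by norm_num
  · have hcount : ∀ ω, (X ω).countP p = n / 2 := fun ω => by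
      rw [List.countP_eq_length_filter, ← List.toFinset_card_of_nodup (hfR _ (hX ω)).1,
        (hfR _ (hX ω)).2, hRb]
    set m : ℕ → ℝ := fun i => ∑ ω, if mark p (X ω) i then w ω else 0 with hm
    have hmw : ∀ i, m i = ∑ ω, w ω * if mark p (X ω) i then 1 else 0 := fun i => by simp [hm]
    have hM : ∑ ω, w ω * -Real.log (QM fun i => mark p (X ω) i) =
        ∑ i ∈ Finset.range n, Real.binEntropy (m i) := by
      rw [hQME, Fin.sum_univ_eq_sum_range (fun i => Real.binEntropy (m i))]
    have hbal : 2 * (n : ℝ) ^ 2 ≤ 9 * (((n - n / 2 : ℕ) : ℝ) * ((n / 2 : ℕ) : ℝ)) := by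
      norm_cast
      obtain ⟨k, hk | hk⟩ := n.even_or_odd'
      · rw [show n - n / 2 = k by omega, show n / 2 = k by omega, hk]; nlinarith
      · rw [show n - n / 2 = k + 1 by omega, show n / 2 = k by omega, hk]
        have : 1 ≤ k := by omega
        nlinarith
    have hsum : ∑ i ∈ Finset.range n, m i = ((n / 2 : ℕ) : ℝ) := by
      simp only [hmw]
      rw [Finset.sum_comm]
      have : ∀ ω, ∑ i ∈ Finset.range n, (w ω * if mark p (X ω) i then 1 else 0) =
          w ω * ((n / 2 : ℕ) : ℝ) := fun ω => by
        rw [← Finset.mul_sum, ← hcount ω, ← sum_mark, hlen _ (hX ω)]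
      rw [Finset.sum_congr rfl fun ω _ => this ω, ← Finset.sum_mul, hw1, one_mul]
    have hrank : ((n / 2 : ℕ) : ℝ) * ((n / 2 : ℕ) - 1) / 2 +
        (1 / 2 + ε) * (((n - n / 2 : ℕ) : ℝ) * (n / 2 : ℕ)) ≤
        ∑ i ∈ Finset.range n, i * m i := by
      have h1 : ∑ i ∈ Finset.range n, i * m i = ∑ ω, w ω *
          ∑ i ∈ Finset.range (X ω).length, i * if mark p (X ω) i then (1 : ℝ) else 0 := by
        simp only [hmw, Finset.mul_sum]
        rw [Finset.sum_comm]
        refine Finset.sum_congr rfl fun ω _ => ?_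
        rw [hlen _ (hX ω)]
        exact Finset.sum_congr rfl fun i _ => by ring
      have h2 : (1 / 2 + ε) * (((n - n / 2 : ℕ) : ℝ) * (n / 2 : ℕ)) ≤
          ∑ ω, w ω * ∑ u ∈ L, ∑ v ∈ R, if [u, v].Sublist (X ω) then (1 : ℝ) else 0 := by
        calc _ = ∑ u ∈ L, ∑ v ∈ R, (1 / 2 + ε) := by
              simp only [Finset.sum_const, nsmul_eq_mul, hLa, hRb]; ring
          _ ≤ ∑ u ∈ L, ∑ v ∈ R, ∑ ω, w ω * if [u, v].Sublist (X ω) then (1 : ℝ) else 0 := by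
              refine Finset.sum_le_sum fun u hu => Finset.sum_le_sum fun v hv => ?_
              simpa using harc u (hLI hu) v (hRI hv) (hLR u hu v hv)
          _ = _ := by
              simp only [Finset.mul_sum]
              symm
              rw [Finset.sum_comm]
              exact Finset.sum_congr rfl fun u _ => Finset.sum_comm
      rw [h1]
      calc _ ≤ _ := add_le_add_right h2 _
        _ = ∑ ω, w ω * (((n / 2 : ℕ) : ℝ) * ((n / 2 : ℕ) - 1) / 2 +
              ∑ u ∈ L, ∑ v ∈ R, if [u, v].Sublist (X ω) then (1 : ℝ) else 0) := by
            simp only [mul_add, Finset.sum_add_distrib]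
            rw [← Finset.sum_mul, hw1, one_mul]
        _ ≤ _ := by
            refine Finset.sum_le_sum fun ω _ => mul_le_mul_of_nonneg_left ?_ (hw0 ω)
            rw [← hcount ω]
            exact agreeing_pairs_le_sum_positions hpL hpR (X ω)
    have hMle := sum_binEntropy_le hε (a := n - n / 2) (b := n / 2) (n := n) (by omega) (by omega)
      (by omega) hbal (fun i => Finset.sum_nonneg fun ω _ => by split_ifs <;> simp [hw0])
      (fun i => by
        rw [← hw1]
        exact Finset.sum_le_sum fun ω _ => by split_ifs <;> simp [hw0]) hsum hrank
    have hsplit : ∀ ω, w ω * -Real.log (QL ((X ω).filter fun x => !p x) * QR ((X ω).filter p) *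
          QM fun i => mark p (X ω) i) =
        w ω * -Real.log (QL ((X ω).filter fun x => !p x)) +
          w ω * -Real.log (QR ((X ω).filter p)) +
          w ω * -Real.log (QM fun i => mark p (X ω) i) := fun ω => by
      rcases (hw0 ω).eq_or_lt with h | h
      · simp [← h]
      · have hl := (hQLpos ω h).ne'
        have hr := (hQRpos ω h).ne'
        rw [Real.log_mul (mul_ne_zero hl hr) (hQMpos ω h).ne', Real.log_mul hl hr]
        ring
    rw [Finset.sum_congr rfl fun ω _ => hsplit ω, Finset.sum_add_distrib, Finset.sum_add_distrib,
      hM]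
    linarith

/-- **Gibbs' inequality** against a subprobability. -/
lemma neg_sum_mul_log_le {S : Type*} [Fintype S] {P Q : S → ℝ} (hP0 : ∀ s, 0 ≤ P s)
    (hP1 : ∑ s, P s = 1) (hQ0 : ∀ s, 0 ≤ Q s) (hQ1 : ∑ s, Q s ≤ 1)
    (hpos : ∀ s, 0 < P s → 0 < Q s) :
    -∑ s, P s * Real.log (P s) ≤ ∑ s, P s * -Real.log (Q s) := by
  have h : ∀ s, P s * Real.log (Q s) - P s * Real.log (P s) ≤ Q s - P s := fun s => by
    rcases (hP0 s).eq_or_lt with h | h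
    · simp [← h, hQ0]
    · have hlog := Real.log_le_sub_one_of_pos (div_pos (hpos s h) h)
      rw [Real.log_div (hpos s h).ne' h.ne'] at hlog
      have := mul_le_mul_of_nonneg_left hlog h.le
      have h2 : P s * (Q s / P s - 1) = Q s - P s := by field_simp
      linarith
  have := Finset.sum_le_sum fun s (_ : s ∈ Finset.univ) => h s
  simp only [Finset.sum_sub_distrib, hP1] at this
  simp only [mul_neg, Finset.sum_neg_distrib]
  linarith

lemma pair_sublist_ofFn_symm {n : ℕ} {σ : Equiv.Perm (Fin n)} {u v : Fin n} (h : σ u < σ v) :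
    [u, v].Sublist (List.ofFn σ.symm) := by
  have hs : [σ u, σ v].Sublist (List.finRange n) := by
    refine List.sublist_of_subperm_of_sortedLE ?_ ?_ ?_
    · exact (List.subperm_of_subset (by simp [h.ne]) (by simp))
    · simpa [List.sortedLE_iff_pairwise] using h.le
    · exact (List.sortedLT_finRange n).sortedLE
  simpa [List.ofFn_eq_map] using hs.map σ.symm

/-- **Transitive case of the Leighton–Moitra theorem.**
If `ε ∈ (0, 1/2)` and `P` is a probability distribution on the permutations of `[n]`
with `P(σ u < σ v) > 1/2 + ε` for all `u < v`, then the binary entropy of `P` is at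
most `(1 - ε²/8) · n · log₂ n`. -/
theorem entropy_of_transitive_agreeing_distribution
    (ε : ℝ) (hε0 : 0 < ε) (hε1 : ε < 1 / 2)
    (n : ℕ) (hn : 0 < n)
    (P : Equiv.Perm (Fin n) → ℝ)
    (hP0 : ∀ σ, 0 ≤ P σ)
    (hP1 : (∑ σ : Equiv.Perm (Fin n), P σ) = 1)
    (harc : ∀ u v : Fin n, u < v →
      1 / 2 + ε < ∑ σ ∈ Finset.univ.filter (fun σ : Equiv.Perm (Fin n) => σ u < σ v), P σ) :
    (- ∑ σ : Equiv.Perm (Fin n), P σ * Real.logb 2 (P σ)) ≤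
      (1 - ε ^ 2 / 8) * (n * Real.logb 2 n) := by
  obtain ⟨Q, hQ0, hQK, hQpos, hQE⟩ := exists_ordering_code hP0 hP1 hε0.le Finset.univ
    (fun σ => List.ofFn σ.symm)
    (fun σ => ⟨List.nodup_ofFn.2 σ.symm.injective, by ext x; simp [σ.symm.surjective x]⟩)
    (fun u _ v _ huv => by
      refine (harc u v huv).le.trans ?_
      rw [Finset.sum_filter]
      refine Finset.sum_le_sum fun σ _ => ?_
      by_cases h : σ u < σ v
      · rw [if_pos h, if_pos (pair_sublist_ofFn_symm h)]
      · rw [if_neg h]; split_ifs <;> simp [hP0])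
  have hinj : Function.Injective fun σ : Equiv.Perm (Fin n) => List.ofFn σ.symm := fun σ τ h =>
    Equiv.symm_bijective.injective (DFunLike.coe_injective (List.ofFn_injective h))
  have hsum : ∑ σ : Equiv.Perm (Fin n), Q (List.ofFn σ.symm) ≤ 1 := by
    rw [← Finset.sum_image (f := Q) hinj.injOn]
    refine hQK _ fun l hl => ?_
    obtain ⟨σ, -, rfl⟩ := Finset.mem_image.1 hl
    exact ⟨List.nodup_ofFn.2 σ.symm.injective, by ext x; simp [σ.symm.surjective x]⟩
  have h := (neg_sum_mul_log_le hP0 hP1 (fun σ => hQ0 _) hsum hQpos).trans hQE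
  rw [Finset.card_univ, Fintype.card_fin] at h
  have h2 : 0 < Real.log 2 := Real.log_pos one_lt_two
  simp only [Real.logb, ← mul_div_assoc, ← Finset.sum_div, ← neg_div]
  gcongr
end

section
/- For each real δ ∈ (0, 1) there exists a real β > 0 such that for every positive integer n the following holds: if H is a bipartite graph with (finite, disjoint) parts X and Y satisfying |X| ≥ n and |Y| ≥ n, then there exist subsets X' ⊆ X and Y' ⊆ Y with |X'| ≥ βn and |Y'| ≥ βn such that the pair (X', Y') is δ-regular in H. -/
/-- Density of the pair `(A, B)` in a bipartite graph with edge set `E ⊆ X × Y`. -/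
noncomputable def bipDensity {α : Type} [DecidableEq α] (E : Finset (α × α)) (A B : Finset α) : ℝ :=
  ((E.filter fun p => p.1 ∈ A ∧ p.2 ∈ B).card : ℝ) / ((A.card : ℝ) * (B.card : ℝ))

/-- The pair `(X, Y)` is `δ`-regular for the edge set `E`:
`|d(A,B) − d(X,Y)| < δ` for all `A ⊆ X`, `B ⊆ Y` with `|A| > δ|X|`, `|B| > δ|Y|`. -/
def IsRegularPair {α : Type} [DecidableEq α] (δ : ℝ) (E : Finset (α × α))
    (X Y : Finset α) : Prop :=
  ∀ A ⊆ X, ∀ B ⊆ Y, δ * (X.card : ℝ) < (A.card : ℝ) → δ * (Y.card : ℝ) < (B.card : ℝ) →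
    |bipDensity E A B - bipDensity E X Y| < δ

/-- Number of edges of `E` from `A` to `B`. -/
def edgeCount {α : Type} [DecidableEq α] (E : Finset (α × α)) (A B : Finset α) : ℕ :=
  (E.filter fun p => p.1 ∈ A ∧ p.2 ∈ B).card

section EdgeCount

variable {α : Type} [DecidableEq α] (E : Finset (α × α)) {A B X Y : Finset α}

theorem edgeCount_le (A B : Finset α) : edgeCount E A B ≤ A.card * B.card := by
  rw [← Finset.card_product]
  refine Finset.card_le_card fun p hp => ?_
  simpa using (Finset.mem_filter.1 hp).2

theorem edgeCount_sdiff_left (hA : A ⊆ X) (B : Finset α) :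
    edgeCount E X B = edgeCount E A B + edgeCount E (X \ A) B := by
  unfold edgeCount
  rw [← Finset.card_union_of_disjoint]
  · congr 1
    ext p
    have := @hA p.1
    simp only [Finset.mem_filter, Finset.mem_union, Finset.mem_sdiff]
    tauto
  · rw [Finset.disjoint_left]
    intro p
    simp only [Finset.mem_filter, Finset.mem_sdiff]
    tauto

theorem edgeCount_sdiff_right (A : Finset α) (hB : B ⊆ Y) :
    edgeCount E A Y = edgeCount E A B + edgeCount E A (Y \ B) := by
  unfold edgeCount
  rw [← Finset.card_union_of_disjoint]
  · congr 1
    ext p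
    have := @hB p.2
    simp only [Finset.mem_filter, Finset.mem_union, Finset.mem_sdiff]
    tauto
  · rw [Finset.disjoint_left]
    intro p
    simp only [Finset.mem_filter, Finset.mem_sdiff]
    tauto

theorem bipDensity_eq (A B : Finset α) :
    bipDensity E A B = (edgeCount E A B : ℝ) / ((A.card : ℝ) * (B.card : ℝ)) := rfl

theorem bipDensity_nonneg (A B : Finset α) : 0 ≤ bipDensity E A B := by
  rw [bipDensity_eq]
  positivity

theorem bipDensity_le_one (A B : Finset α) : bipDensity E A B ≤ 1 :=
  div_le_one_of_le₀ (mod_cast edgeCount_le E A B) (by positivity)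

/-- A rectangle with many excess edges over density `d ≥ 0` is large and denser than `d`. -/
theorem large_and_dense_of_excess (hA : A ⊆ X) (hB : B ⊆ Y) (hX : X.Nonempty) (hY : Y.Nonempty)
    {c d : ℝ} (hc : 0 < c) (hd : 0 ≤ d)
    (h : c * ((X.card : ℝ) * Y.card) ≤ edgeCount E A B - d * ((A.card : ℝ) * B.card)) :
    c * X.card ≤ (A.card : ℝ) ∧ c * Y.card ≤ (B.card : ℝ) ∧ d + c ≤ bipDensity E A B := by
  have hX0 : (0 : ℝ) < X.card := mod_cast hX.card_pos
  have hY0 : (0 : ℝ) < Y.card := mod_cast hY.card_pos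
  have hAX : (A.card : ℝ) ≤ X.card := mod_cast Finset.card_le_card hA
  have hBY : (B.card : ℝ) ≤ Y.card := mod_cast Finset.card_le_card hB
  have hA0 : (0 : ℝ) ≤ A.card := by positivity
  have hB0 : (0 : ℝ) ≤ B.card := by positivity
  have he : (edgeCount E A B : ℝ) ≤ A.card * B.card := mod_cast edgeCount_le E A B
  have hdAB : 0 ≤ d * ((A.card : ℝ) * B.card) := by positivity
  have hlarge : c * ((X.card : ℝ) * Y.card) ≤ A.card * B.card := by linarith
  have hpos : (0 : ℝ) < A.card * B.card := lt_of_lt_of_le (by positivity) hlarge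
  have hAB : (A.card : ℝ) * B.card ≤ X.card * Y.card := by gcongr
  refine ⟨?_, ?_, ?_⟩
  · refine le_of_mul_le_mul_right ?_ hY0
    calc c * X.card * Y.card = c * ((X.card : ℝ) * Y.card) := by ring
      _ ≤ A.card * B.card := hlarge
      _ ≤ A.card * Y.card := by gcongr
  · refine le_of_mul_le_mul_left ?_ hX0
    calc X.card * (c * Y.card) = c * ((X.card : ℝ) * Y.card) := by ring
      _ ≤ A.card * B.card := hlarge
      _ ≤ X.card * B.card := by gcongr
  · rw [bipDensity_eq, le_div_iff₀ hpos, add_mul]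
    linarith [mul_le_mul_of_nonneg_left hAB hc.le]

/-- An irregular pair contains a large pair of noticeably larger density. -/
theorem exists_density_increment {δ : ℝ} (hδ : 0 < δ) (h : ¬ IsRegularPair δ E X Y) :
    ∃ X' ⊆ X, ∃ Y' ⊆ Y, δ ^ 3 / 2 * X.card ≤ (X'.card : ℝ) ∧ δ ^ 3 / 2 * Y.card ≤ (Y'.card : ℝ) ∧
      bipDensity E X Y + δ ^ 3 / 2 ≤ bipDensity E X' Y' := by
  unfold IsRegularPair at h
  push Not at h
  obtain ⟨A, hA, B, hB, hAc, hBc, hdev⟩ := h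
  have hA0 : (0 : ℝ) < A.card := lt_of_le_of_lt (by positivity) hAc
  have hB0 : (0 : ℝ) < B.card := lt_of_le_of_lt (by positivity) hBc
  have hX : X.Nonempty := (Finset.card_pos.1 (mod_cast hA0)).mono hA
  have hY : Y.Nonempty := (Finset.card_pos.1 (mod_cast hB0)).mono hB
  have hX0 : (0 : ℝ) < X.card := mod_cast hX.card_pos
  have hY0 : (0 : ℝ) < Y.card := mod_cast hY.card_pos
  have hc : 0 < δ ^ 3 / 2 := by positivity
  set d := bipDensity E X Y with hd
  have hd0 : 0 ≤ d := bipDensity_nonneg E X Y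
  have hmass : δ ^ 3 * ((X.card : ℝ) * Y.card) ≤ δ * (A.card * B.card) := by
    calc δ ^ 3 * ((X.card : ℝ) * Y.card) = δ * ((δ * X.card) * (δ * Y.card)) := by ring
      _ ≤ δ * (A.card * B.card) := by gcongr
  have heAB : (edgeCount E A B : ℝ) = bipDensity E A B * (A.card * B.card) := by
    rw [bipDensity_eq, div_mul_cancel₀ _ (by positivity)]
  have heXY : (edgeCount E X Y : ℝ) = d * (X.card * Y.card) := by
    rw [hd, bipDensity_eq, div_mul_cancel₀ _ (by positivity)]
  have hXY : 0 < δ ^ 3 * ((X.card : ℝ) * Y.card) := by positivity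
  rcases le_abs'.1 hdev with hlow | hhigh
  · have hAB := mul_le_mul_of_nonneg_right hlow (show (0 : ℝ) ≤ A.card * B.card by positivity)
    have h₁ : (edgeCount E X Y : ℝ) =
        edgeCount E A B + edgeCount E A (Y \ B) + edgeCount E (X \ A) Y := by
      rw [edgeCount_sdiff_left E hA Y, edgeCount_sdiff_right E A hB]
      push_cast
      ring
    have hcX : (X.card : ℝ) = (X \ A).card + A.card :=
      mod_cast (Finset.card_sdiff_add_card_eq_card hA).symm
    have hcY : (Y.card : ℝ) = (Y \ B).card + B.card :=
      mod_cast (Finset.card_sdiff_add_card_eq_card hB).symm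
    have hsplit : d * ((X.card : ℝ) * Y.card) = d * (A.card * B.card) +
        d * (A.card * (Y \ B).card) + d * ((X \ A).card * Y.card) := by
      rw [hcX, hcY]
      ring
    by_cases hcase : δ ^ 3 / 2 * ((X.card : ℝ) * Y.card) ≤
        edgeCount E A (Y \ B) - d * ((A.card : ℝ) * (Y \ B).card)
    · exact ⟨A, hA, Y \ B, Finset.sdiff_subset,
        large_and_dense_of_excess E hA Finset.sdiff_subset hX hY hc hd0 hcase⟩
    · refine ⟨X \ A, Finset.sdiff_subset, Y, subset_rfl,
        large_and_dense_of_excess E Finset.sdiff_subset subset_rfl hX hY hc hd0 ?_⟩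
      linarith
  · refine ⟨A, hA, B, hB, large_and_dense_of_excess E hA hB hX hY hc hd0 ?_⟩
    have hAB := mul_le_mul_of_nonneg_right hhigh (show (0 : ℝ) ≤ A.card * B.card by positivity)
    linarith

theorem exists_isRegularPair_of_lt_density {δ : ℝ} (hδ0 : 0 < δ) (hδ1 : δ < 1) (k : ℕ) :
    ∀ X Y : Finset α, 1 - k * (δ ^ 3 / 2) < bipDensity E X Y →
      ∃ X' ⊆ X, ∃ Y' ⊆ Y, (δ ^ 3 / 2) ^ k * X.card ≤ (X'.card : ℝ) ∧
        (δ ^ 3 / 2) ^ k * Y.card ≤ (Y'.card : ℝ) ∧ IsRegularPair δ E X' Y' := by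
  have hc0 : 0 < δ ^ 3 / 2 := by positivity
  have hc1 : δ ^ 3 / 2 ≤ 1 := by linarith [pow_le_one₀ (n := 3) hδ0.le hδ1.le]
  induction k with
  | zero =>
    intro X Y h
    have := bipDensity_le_one E X Y
    norm_num at h
    linarith
  | succ k ih =>
    intro X Y h
    by_cases hreg : IsRegularPair δ E X Y
    · have hpow : (δ ^ 3 / 2) ^ (k + 1) ≤ 1 := pow_le_one₀ hc0.le hc1
      exact ⟨X, subset_rfl, Y, subset_rfl, mul_le_of_le_one_left (by positivity) hpow,
        mul_le_of_le_one_left (by positivity) hpow, hreg⟩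
    · obtain ⟨X₁, hX₁, Y₁, hY₁, hcX, hcY, hd⟩ := exists_density_increment E hδ0 hreg
      obtain ⟨X₂, hX₂, Y₂, hY₂, hcX₂, hcY₂, hreg₂⟩ := ih X₁ Y₁ (by push_cast at h; linarith)
      refine ⟨X₂, hX₂.trans hX₁, Y₂, hY₂.trans hY₁, ?_, ?_, hreg₂⟩
      · rw [pow_succ, mul_assoc]
        exact (mul_le_mul_of_nonneg_left hcX (by positivity)).trans hcX₂
      · rw [pow_succ, mul_assoc]
        exact (mul_le_mul_of_nonneg_left hcY (by positivity)).trans hcY₂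

end EdgeCount

/-- **A weak regularity lemma (Komlós).**  For each `δ ∈ (0,1)` there is `β > 0` such that
any bipartite graph with parts of size at least `n` contains a `δ`-regular pair `(X', Y')`
with `|X'|, |Y'| ≥ βn`. -/
theorem exists_regular_pair
    (δ : ℝ) (hδ0 : 0 < δ) (hδ1 : δ < 1) :
    ∃ β : ℝ, 0 < β ∧
      ∀ (n : ℕ), 0 < n →
      ∀ (α : Type) [DecidableEq α] (X Y : Finset α), Disjoint X Y →
        (n : ℝ) ≤ X.card → (n : ℝ) ≤ Y.card →
      ∀ (E : Finset (α × α)), (∀ p ∈ E, p.1 ∈ X ∧ p.2 ∈ Y) →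
      ∃ X' ⊆ X, ∃ Y' ⊆ Y,
        β * n ≤ (X'.card : ℝ) ∧ β * n ≤ (Y'.card : ℝ) ∧ IsRegularPair δ E X' Y' := by
  have hc0 : 0 < δ ^ 3 / 2 := by positivity
  obtain ⟨k, hk⟩ := exists_nat_gt (1 / (δ ^ 3 / 2))
  rw [div_lt_iff₀ hc0] at hk
  refine ⟨(δ ^ 3 / 2) ^ k, by positivity, fun n _ α _ X Y _ hX hY E _ => ?_⟩
  obtain ⟨X', hX', Y', hY', hcX, hcY, hreg⟩ := exists_isRegularPair_of_lt_density E hδ0 hδ1 k X Y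
    (lt_of_lt_of_le (by linarith) (bipDensity_nonneg E X Y))
  exact ⟨X', hX', Y', hY', (mul_le_mul_of_nonneg_left hX (by positivity)).trans hcX,
    (mul_le_mul_of_nonneg_left hY (by positivity)).trans hcY, hreg⟩
end

section
/- For each real δ ∈ (0, 1) there exists a real β > 0 such that for every finite directed graph G = (V, E) (with E a set of ordered pairs of distinct vertices) with |V| ≥ 2, there is a partition V = L ∪ R ∪ W into pairwise disjoint sets such that the arc set E ∩ (L × R) is δ-regular between L and R, and min{|L|, |R|} ≥ β|V|/2. -/
/-- Density of the pair `(A, B)` for a set of arcs `D`. -/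
noncomputable def arcDensity {α : Type} [DecidableEq α] (D : Finset (α × α))
    (A B : Finset α) : ℝ :=
  ((D.filter fun p => p.1 ∈ A ∧ p.2 ∈ B).card : ℝ) / ((A.card : ℝ) * (B.card : ℝ))

/-- A set of arcs `D ⊆ L × R` is `δ`-regular between `L` and `R`:
`|d(A,B) − d(L,R)| < δ` for all `A ⊆ L`, `B ⊆ R` with `|A| > δ|L|`, `|B| > δ|R|`. -/
def IsRegularArcs {α : Type} [DecidableEq α] (δ : ℝ) (D : Finset (α × α))
    (L R : Finset α) : Prop :=
  ∀ A ⊆ L, ∀ B ⊆ R, δ * (L.card : ℝ) < (A.card : ℝ) → δ * (R.card : ℝ) < (B.card : ℝ) →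
    |arcDensity D A B - arcDensity D L R| < δ

open Finset in
/-- The number of arcs of `D` from `A` to `B`. -/
def arcCount {α : Type} [DecidableEq α] (D : Finset (α × α)) (A B : Finset α) : ℕ :=
  #{p ∈ D | p.1 ∈ A ∧ p.2 ∈ B}

section ArcCount

open Finset

variable {α : Type} [DecidableEq α] (D : Finset (α × α)) (A B L R : Finset α)

lemma arcDensity_eq_arcCount_div :
    arcDensity D A B = (arcCount D A B : ℝ) / ((#A : ℝ) * #B) := rfl

lemma arcCount_le_card_mul_card : arcCount D A B ≤ #A * #B := by
  rw [← card_product]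
  refine card_le_card fun p hp => ?_
  simpa using (mem_filter.1 hp).2

lemma arcCount_le_add_add_add :
    arcCount D L R ≤
      arcCount D A B + arcCount D (L \ A) B + arcCount D A (R \ B)
        + arcCount D (L \ A) (R \ B) := by
  unfold arcCount
  refine le_trans (card_le_card (t := (({p ∈ D | p.1 ∈ A ∧ p.2 ∈ B} ∪
    {p ∈ D | p.1 ∈ L \ A ∧ p.2 ∈ B}) ∪ {p ∈ D | p.1 ∈ A ∧ p.2 ∈ R \ B}) ∪
    {p ∈ D | p.1 ∈ L \ A ∧ p.2 ∈ R \ B}) ?_) ?_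
  · intro p hp
    simp only [mem_filter, mem_union, mem_sdiff] at hp ⊢
    tauto
  · refine (card_union_le _ _).trans (Nat.add_le_add_right ?_ _)
    refine (card_union_le _ _).trans (Nat.add_le_add_right ?_ _)
    exact card_union_le _ _

lemma arcCount_add_arcCount_sdiff {X Y : Finset α} (hD : D ⊆ X ×ˢ Y) (hA : A ⊆ X) (hB : B ⊆ Y) :
    arcCount D A B + arcCount ((X ×ˢ Y) \ D) A B = #A * #B := by
  unfold arcCount
  rw [← card_union_of_disjoint
    (disjoint_filter_filter disjoint_sdiff), ← filter_union, union_sdiff_of_subset hD,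
    ← card_product]
  congr 1
  ext p
  simp only [mem_filter, mem_product]
  exact ⟨fun h => h.2, fun h => ⟨⟨hA h.1, hB h.2⟩, h⟩⟩

lemma arcDensity_sdiff {X Y : Finset α} (hD : D ⊆ X ×ˢ Y) (hA : A ⊆ X) (hB : B ⊆ Y)
    (hA0 : A.Nonempty) (hB0 : B.Nonempty) :
    arcDensity ((X ×ˢ Y) \ D) A B = 1 - arcDensity D A B := by
  have h : (arcCount D A B : ℝ) + arcCount ((X ×ˢ Y) \ D) A B = #A * #B :=
    mod_cast arcCount_add_arcCount_sdiff D A B hD hA hB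
  have hA' : (0 : ℝ) < #A := mod_cast hA0.card_pos
  have hB' : (0 : ℝ) < #B := mod_cast hB0.card_pos
  rw [arcDensity_eq_arcCount_div, arcDensity_eq_arcCount_div]
  field_simp
  linarith

lemma arcDensity_filter_of_subset {X Y : Finset α} (hA : A ⊆ X) (hB : B ⊆ Y) :
    arcDensity (D.filter fun p => p.1 ∈ X ∧ p.2 ∈ Y) A B = arcDensity D A B := by
  unfold arcDensity
  rw [filter_filter]
  congr 3
  ext p
  simp only [mem_filter]
  exact ⟨fun h => ⟨h.1, h.2.2⟩, fun h => ⟨h.1, ⟨hA h.2.1, hB h.2.2⟩, h.2⟩⟩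

end ArcCount

lemma Real.rpow_one_sub_le_add {p c : ℝ} (hp : 0 ≤ p) (hc0 : 0 ≤ c) (hc1 : c ≤ 1) :
    p ^ (1 - c) ≤ p + c := by
  have h := Real.geom_mean_le_arith_mean2_weighted (sub_nonneg.2 hc1) hc0 hp zero_le_one (by ring)
  rw [Real.one_rpow] at h
  nlinarith [mul_nonneg hc0 hp]

section Maximal

open Finset

variable {α : Type} [DecidableEq α]

/-- Every set of arcs of density at least `1/2` between `X` and `Y` has a large pair `(L, R)` for
which no pair of subsets contains many more arcs than its share of `L × R` predicts. -/
lemma exists_arcCount_le_mul (D : Finset (α × α)) {X Y : Finset α} {c : ℝ} (hc0 : 0 < c)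
    (hc1 : c < 1) (hX : X.Nonempty) (hY : Y.Nonempty)
    (hD : (#X : ℝ) * #Y ≤ 2 * arcCount D X Y) :
    ∃ L ⊆ X, ∃ R ⊆ Y, (1 / 2 : ℝ) ^ (1 / c) * (#X * #Y) ≤ #L * #R ∧ 0 < arcCount D L R ∧
      ∀ A ⊆ L, ∀ B ⊆ R, (arcCount D A B : ℝ) ≤
        arcCount D L R * ((#A : ℝ) * #B / (#L * #R) + c) := by
  obtain ⟨⟨L, R⟩, hLR, hmax⟩ := exists_max_image (X.powerset ×ˢ Y.powerset)
    (fun q => (arcCount D q.1 q.2 : ℝ) / ((#q.1 : ℝ) * #q.2) ^ (1 - c))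
    ⟨(X, Y), by simp⟩
  simp only [mem_product, mem_powerset, Prod.forall, and_imp] at hLR hmax
  have hX' : (0 : ℝ) < #X := mod_cast hX.card_pos
  have hY' : (0 : ℝ) < #Y := mod_cast hY.card_pos
  have hXY : (0 : ℝ) < #X * #Y := mul_pos hX' hY'
  have hXYmax := hmax X Y Subset.rfl Subset.rfl
  have hsplit {x : ℝ} (hx : 0 < x) : x = x ^ (1 - c) * x ^ c := by
    rw [← Real.rpow_add hx]; simp
  have hlow : 1 / 2 * ((#X : ℝ) * #Y) ^ c ≤ (arcCount D X Y : ℝ) / ((#X : ℝ) * #Y) ^ (1 - c) := by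
    rw [le_div_iff₀ (Real.rpow_pos_of_pos hXY _)]
    have := hsplit hXY
    linarith
  have hpos : 0 < (arcCount D L R : ℝ) / ((#L : ℝ) * #R) ^ (1 - c) :=
    lt_of_lt_of_le (mul_pos one_half_pos (Real.rpow_pos_of_pos hXY _)) (hlow.trans hXYmax)
  have hLR0 : (0 : ℝ) ≤ #L * #R := mul_nonneg (Nat.cast_nonneg _) (Nat.cast_nonneg _)
  have he : 0 < arcCount D L R := by
    rcases Nat.eq_zero_or_pos (arcCount D L R) with h | h
    · simp [h] at hpos
    · exact h
  have heLR : (arcCount D L R : ℝ) ≤ #L * #R := mod_cast arcCount_le_card_mul_card D L R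
  have heR : (0 : ℝ) < arcCount D L R := mod_cast he
  have hLRpos : (0 : ℝ) < #L * #R := heR.trans_le heLR
  refine ⟨L, hLR.1, R, hLR.2, ?_, he, fun A hA B hB => ?_⟩
  · have hup : (arcCount D L R : ℝ) / ((#L : ℝ) * #R) ^ (1 - c) ≤ ((#L : ℝ) * #R) ^ c := by
      rw [div_le_iff₀ (Real.rpow_pos_of_pos hLRpos _), mul_comm, ← hsplit hLRpos]
      exact heLR
    have h := (hlow.trans hXYmax).trans hup
    rw [← Real.rpow_le_rpow_iff
      (mul_nonneg (Real.rpow_nonneg one_half_pos.le _) hXY.le) hLR0 hc0,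
      Real.mul_rpow (Real.rpow_nonneg one_half_pos.le _) hXY.le, ← Real.rpow_mul (by norm_num),
      one_div_mul_cancel hc0.ne', Real.rpow_one]
    exact h
  · have hAB : (0 : ℝ) ≤ #A * #B := mul_nonneg (Nat.cast_nonneg _) (Nat.cast_nonneg _)
    have h := hmax A B (hA.trans hLR.1) (hB.trans hLR.2)
    refine le_trans ?_ (mul_le_mul_of_nonneg_left
      (Real.rpow_one_sub_le_add (div_nonneg hAB hLR0) hc0.le hc1.le) heR.le)
    rw [Real.div_rpow hAB hLR0]
    rcases hAB.eq_or_lt with h0 | h0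
    · have : (arcCount D A B : ℝ) ≤ #A * #B := mod_cast arcCount_le_card_mul_card D A B
      refine le_trans (this.trans h0.symm.le)
        (mul_nonneg heR.le (div_nonneg (Real.rpow_nonneg hAB _) (Real.rpow_nonneg hLR0 _)))
    · rw [div_le_iff₀ (Real.rpow_pos_of_pos h0 _)] at h
      calc _ ≤ _ := h
        _ = _ := by ring

/-- A set of arcs of density at least `1/2` between `X` and `Y` has a large regular pair. -/
lemma exists_regular_pair_of_dense (D : Finset (α × α)) {X Y : Finset α} {δ : ℝ} (hδ0 : 0 < δ)
    (hδ1 : δ < 1) (hX : X.Nonempty) (hY : Y.Nonempty)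
    (hD : (#X : ℝ) * #Y ≤ 2 * arcCount D X Y) :
    ∃ L ⊆ X, ∃ R ⊆ Y, (1 / 2 : ℝ) ^ (1 / (δ ^ 3 / 3)) * (#X * #Y) ≤ #L * #R ∧
      ∀ A ⊆ L, ∀ B ⊆ R, δ * (#L : ℝ) < #A → δ * (#R : ℝ) < #B →
        |arcDensity D A B - arcDensity D L R| < δ := by
  have hδ3 : δ ^ 3 < 1 := pow_lt_one₀ hδ0.le hδ1 (by norm_num)
  obtain ⟨L, hL, R, hR, hsize, he, hmax⟩ := exists_arcCount_le_mul D (c := δ ^ 3 / 3)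
    (by positivity) (by linarith) hX hY hD
  refine ⟨L, hL, R, hR, hsize, fun A hA B hB hAc hBc => ?_⟩
  have heR : (0 : ℝ) < arcCount D L R := mod_cast he
  have heLR : (arcCount D L R : ℝ) ≤ #L * #R := mod_cast arcCount_le_card_mul_card D L R
  have hLR : (0 : ℝ) < #L * #R := heR.trans_le heLR
  have hl : (0 : ℝ) < #L := pos_of_mul_pos_left hLR (by positivity)
  have hr : (0 : ℝ) < #R := pos_of_mul_pos_right hLR (by positivity)
  have ha : (0 : ℝ) < #A := (mul_pos hδ0 hl).trans hAc
  have hb : (0 : ℝ) < #B := (mul_pos hδ0 hr).trans hBc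
  have hab : δ ^ 2 * (#L * #R : ℝ) < #A * #B := by
    have := mul_lt_mul'' hAc hBc (by positivity) (by positivity)
    linarith
  have hdef : δ ^ 3 * (#L * #R : ℝ) < δ * (#A * #B) := by
    have := mul_lt_mul_of_pos_left hab hδ0
    linarith
  have h₁ := hmax A hA B hB
  have h₂ := hmax (L \ A) sdiff_subset B hB
  have h₃ := hmax A hA (R \ B) sdiff_subset
  have h₄ := hmax (L \ A) sdiff_subset (R \ B) sdiff_subset
  have hsum : (arcCount D L R : ℝ) ≤ arcCount D A B + arcCount D (L \ A) B
      + arcCount D A (R \ B) + arcCount D (L \ A) (R \ B) :=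
    mod_cast arcCount_le_add_add_add D A B L R
  rw [cast_card_sdiff hA] at h₂ h₄
  rw [cast_card_sdiff hB] at h₃ h₄
  rw [arcDensity_eq_arcCount_div, arcDensity_eq_arcCount_div]
  set l : ℝ := (#L : ℝ)
  set r : ℝ := (#R : ℝ)
  set a : ℝ := (#A : ℝ)
  set b : ℝ := (#B : ℝ)
  set e : ℝ := (arcCount D L R : ℝ)
  set f : ℝ := (arcCount D A B : ℝ)
  have hab0 : 0 < a * b := mul_pos ha hb
  set d := e / (l * r) with hd
  have hd0 : 0 < d := div_pos heR hLR
  have hd1 : d ≤ 1 := (div_le_one hLR).2 heLR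
  have hde : e = d * (l * r) := by rw [hd]; field_simp
  have hscale (x : ℝ) : e * (x / (l * r) + δ ^ 3 / 3) = d * (x + δ ^ 3 / 3 * (l * r)) := by
    rw [hd]; field_simp
  rw [hscale] at h₁ h₂ h₃ h₄
  have hderr : d * (δ ^ 3 * (l * r)) < δ * (a * b) :=
    (mul_le_of_le_one_left ((mul_pos (pow_pos hδ0 3) hLR).le) hd1).trans_lt hdef
  rw [abs_sub_lt_iff]
  constructor
  · rw [sub_lt_iff_lt_add, div_lt_iff₀ hab0]
    have : 0 < δ * (a * b) := mul_pos hδ0 hab0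
    nlinarith
  · rw [sub_lt_comm, lt_div_iff₀ hab0]
    nlinarith

/-- Every set of arcs between `X` and `Y` has a large regular pair. -/
lemma exists_regular_pair_s3 (D : Finset (α × α)) {X Y : Finset α} {δ : ℝ} (hδ0 : 0 < δ)
    (hδ1 : δ < 1) (hX : X.Nonempty) (hY : Y.Nonempty) (hD : D ⊆ X ×ˢ Y) :
    ∃ L ⊆ X, ∃ R ⊆ Y, (1 / 2 : ℝ) ^ (1 / (δ ^ 3 / 3)) * (#X * #Y) ≤ #L * #R ∧
      ∀ A ⊆ L, ∀ B ⊆ R, δ * (#L : ℝ) < #A → δ * (#R : ℝ) < #B →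
        |arcDensity D A B - arcDensity D L R| < δ := by
  rcases le_total ((#X : ℝ) * #Y) (2 * arcCount D X Y) with h | h
  · exact exists_regular_pair_of_dense D hδ0 hδ1 hX hY h
  have hcompl : (arcCount D X Y : ℝ) + arcCount ((X ×ˢ Y) \ D) X Y = #X * #Y :=
    mod_cast arcCount_add_arcCount_sdiff D X Y hD Subset.rfl Subset.rfl
  obtain ⟨L, hL, R, hR, hsize, hreg⟩ :=
    exists_regular_pair_of_dense ((X ×ˢ Y) \ D) hδ0 hδ1 hX hY (by linarith)
  refine ⟨L, hL, R, hR, hsize, fun A hA B hB hAc hBc => ?_⟩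
  have hA0 : A.Nonempty := card_pos.1 (Nat.cast_pos.1 ((by positivity : 0 ≤ δ * _).trans_lt hAc))
  have hB0 : B.Nonempty := card_pos.1 (Nat.cast_pos.1 ((by positivity : 0 ≤ δ * _).trans_lt hBc))
  have := hreg A hA B hB hAc hBc
  rwa [arcDensity_sdiff D A B hD (hA.trans hL) (hB.trans hR) hA0 hB0,
    arcDensity_sdiff D L R hD hL hR (hA0.mono hA) (hB0.mono hB), sub_sub_sub_cancel_left,
    abs_sub_comm] at this

end Maximal

/-- **Corollary of the weak regularity lemma.**  For each `δ ∈ (0,1)` there is `β > 0`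
such that any finite digraph `G = (V, E)` with `|V| ≥ 2` admits a partition
`V = L ∪ R ∪ W` with `E ∩ (L × R)` `δ`-regular and `min{|L|,|R|} ≥ β|V|/2`. -/
theorem exists_regular_partition
    (δ : ℝ) (hδ0 : 0 < δ) (hδ1 : δ < 1) :
    ∃ β : ℝ, 0 < β ∧
      ∀ (α : Type) [DecidableEq α] (V : Finset α) (E : Finset (α × α)),
        (∀ p ∈ E, p.1 ∈ V ∧ p.2 ∈ V ∧ p.1 ≠ p.2) →
        2 ≤ V.card →
        ∃ L R W : Finset α,
          L ∪ R ∪ W = V ∧ Disjoint L R ∧ Disjoint L W ∧ Disjoint R W ∧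
          IsRegularArcs δ (E.filter fun p => p.1 ∈ L ∧ p.2 ∈ R) L R ∧
          β * (V.card : ℝ) / 2 ≤ min (L.card : ℝ) (R.card : ℝ) := by
  set κ : ℝ := (1 / 2 : ℝ) ^ (1 / (δ ^ 3 / 3)) with hκ
  have hκ0 : 0 < κ := by positivity
  refine ⟨κ / 2, by positivity, fun α _ V E _ hV => ?_⟩
  obtain ⟨X, hXV, hXc⟩ := Finset.exists_subset_card_eq (Nat.div_le_self V.card 2)
  have hYc : (V \ X).card = V.card - V.card / 2 := by rw [Finset.card_sdiff_of_subset hXV, hXc]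
  have hX : X.Nonempty := Finset.card_pos.1 (by omega)
  have hY : (V \ X).Nonempty := Finset.card_pos.1 (by omega)
  obtain ⟨L, hL, R, hR, hsize, hreg⟩ :=
    exists_regular_pair_s3 (E.filter fun p => p.1 ∈ X ∧ p.2 ∈ V \ X) hδ0 hδ1 hX hY
      (fun p hp => Finset.mem_product.2 (Finset.mem_filter.1 hp).2)
  rw [← hκ] at hsize
  have hRV : R ⊆ V := hR.trans Finset.sdiff_subset
  refine ⟨L, R, V \ (L ∪ R), Finset.union_sdiff_of_subset
      (Finset.union_subset (hL.trans hXV) hRV),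
    Finset.disjoint_of_subset_left hL (Finset.disjoint_of_subset_right hR Finset.disjoint_sdiff),
    Finset.disjoint_of_subset_left Finset.subset_union_left Finset.disjoint_sdiff,
    Finset.disjoint_of_subset_left Finset.subset_union_right Finset.disjoint_sdiff,
    fun A hA B hB hAc hBc => ?_, ?_⟩
  · have h := hreg A hA B hB hAc hBc
    rw [arcDensity_filter_of_subset E A B (hA.trans hL) (hB.trans hR),
      arcDensity_filter_of_subset E L R hL hR] at h
    rwa [arcDensity_filter_of_subset E A B hA hB,
      arcDensity_filter_of_subset E L R Finset.Subset.rfl Finset.Subset.rfl]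
  · have hLX : (L.card : ℝ) ≤ X.card := mod_cast Finset.card_le_card hL
    have hRY : (R.card : ℝ) ≤ (V \ X).card := mod_cast Finset.card_le_card hR
    have hX0 : (0 : ℝ) < X.card := mod_cast hX.card_pos
    have hY0 : (0 : ℝ) < (V \ X).card := mod_cast hY.card_pos
    have hXb : (V.card : ℝ) ≤ 4 * X.card := mod_cast (by omega : V.card ≤ 4 * X.card)
    have hYb : (V.card : ℝ) ≤ 4 * (V \ X).card := mod_cast (by omega : V.card ≤ 4 * (V \ X).card)
    have hLκ : κ * X.card ≤ L.card := by
      refine le_of_mul_le_mul_right ?_ hY0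
      nlinarith [mul_le_mul_of_nonneg_left hRY (Nat.cast_nonneg (α := ℝ) L.card)]
    have hRκ : κ * (V \ X).card ≤ R.card := by
      refine le_of_mul_le_mul_right ?_ hX0
      nlinarith [mul_le_mul_of_nonneg_right hLX (Nat.cast_nonneg (α := ℝ) R.card)]
    refine le_min ?_ ?_
    · linarith [mul_le_mul_of_nonneg_left hXb hκ0.le]
    · linarith [mul_le_mul_of_nonneg_left hYb hκ0.le]
end

section
/- Let b ≥ 2 be a real number, let t > 0 be real, let r ≥ 1, and let u_1, …, u_r be positive reals with u_i ≤ t for every i and s = ∑_{i=1}^r u_i. Let d_1, …, d_r be nonnegative integers with ∑_{i=1}^r b^{−d_i} ≤ 1. Then ∑_{i=1}^r u_i·d_i ≥ s·log_b(s/t). -/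
/-- The summand of Gibbs' inequality, with `u` bounded above by `t`. -/
theorem mul_log_div_sub_le {b s t u : ℝ} (hb : 0 < b) (hs : 0 < s) (hu : 0 < u) (hut : u ≤ t)
    (x : ℝ) :
    u * Real.log (s / t) - u * x * Real.log b ≤ s * b ^ (-x) - u := by
  have hbx : 0 < b ^ (-x) := Real.rpow_pos_of_pos hb _
  have hle : Real.log (s / t) ≤ Real.log (s / u) :=
    Real.log_le_log (div_pos hs (hu.trans_le hut)) (by gcongr)
  have hlog : Real.log (s / u * b ^ (-x)) = Real.log (s / u) + -x * Real.log b := by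
    rw [Real.log_mul (div_pos hs hu).ne' hbx.ne', Real.log_rpow hb]
  have hsub := Real.log_le_sub_one_of_pos (mul_pos (div_pos hs hu) hbx)
  calc u * Real.log (s / t) - u * x * Real.log b
      = u * (Real.log (s / t) + -x * Real.log b) := by ring
    _ ≤ u * (s / u * b ^ (-x) - 1) := by gcongr; linarith
    _ = s * b ^ (-x) - u := by field_simp

/-- **Analytic core of the tree lemma.**  If `u_1, …, u_r` are positive reals with
`u_i ≤ t` and sum `s`, and `d_1, …, d_r` are nonnegative integers satisfying Kraft's
inequality `∑ b^{-d_i} ≤ 1` for some real `b ≥ 2`, then `∑ u_i d_i ≥ s · log_b (s/t)`. -/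
theorem sum_mul_depth_ge
    (b t : ℝ) (hb : 2 ≤ b) (ht : 0 < t)
    (r : ℕ) (hr : 1 ≤ r)
    (u : Fin r → ℝ) (hu : ∀ i, 0 < u i) (hut : ∀ i, u i ≤ t)
    (d : Fin r → ℕ)
    (hKraft : (∑ i, b ^ (-(d i : ℝ))) ≤ 1) :
    (∑ i, u i) * Real.logb b ((∑ i, u i) / t) ≤ ∑ i, u i * (d i : ℝ) := by
  have hlogb : 0 < Real.log b := Real.log_pos (by linarith)
  have hs : 0 < ∑ i, u i :=
    Finset.sum_pos (fun i _ => hu i) ⟨⟨0, hr⟩, Finset.mem_univ _⟩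
  have hsum := Finset.sum_le_sum fun i (_ : i ∈ Finset.univ) =>
    mul_log_div_sub_le (b := b) (by linarith) hs (hu i) (hut i) (d i)
  rw [Finset.sum_sub_distrib, Finset.sum_sub_distrib, ← Finset.sum_mul, ← Finset.sum_mul,
    ← Finset.mul_sum] at hsum
  have hmul := mul_le_mul_of_nonneg_left hKraft hs.le
  rw [Real.logb, ← mul_div_assoc, div_le_iff₀ hlogb]
  linarith
end

section
/- Let ε > 0, let m be a positive integer, and let 𝒴 be a random m-element subset of [2m] (i.e., a random variable taking values in the m-element subsets of [2m]) such that E|{(a,b) : a < b, a ∈ [2m] \ 𝒴, b ∈ 𝒴}| > (1/2 + ε)·m². Then the binary entropy of 𝒴 satisfies H(𝒴) ≤ (1 − ε²/8)·2m. -/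
/-- Pairs `a < b` with `a ∉ S`, `b ∈ S`, together with the pairs inside `S`, are counted by the
sum of the elements of `S`. -/
theorem card_inversions_add_card_pairs {n : ℕ} (S : Finset (Fin n)) :
    (Finset.univ.filter
        (fun p : Fin n × Fin n => p.1 < p.2 ∧ p.1 ∉ S ∧ p.2 ∈ S)).card +
      (Finset.univ.filter
        (fun p : Fin n × Fin n => p.1 < p.2 ∧ p.1 ∈ S ∧ p.2 ∈ S)).card =
      ∑ b ∈ S, (b : ℕ) := by
  rw [← Finset.card_union_of_disjoint
    (Finset.disjoint_filter.2 fun p _ h h' => h.2.1 h'.2.1), ← Finset.filter_or]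
  rw [Finset.card_eq_sum_card_fiberwise (f := Prod.snd) (t := S)
    (fun p hp => by simp at hp; rcases hp with h | h <;> simp [h.2.2])]
  refine Finset.sum_congr rfl fun b hb => ?_
  rw [← Fin.card_Iio b]
  refine Finset.card_bij' (fun p _ => p.1) (fun a _ => (a, b)) ?_ ?_ ?_ ?_
  · rintro ⟨a, c⟩ h
    simp at h ⊢
    obtain ⟨h, rfl⟩ := h
    tauto
  · intro a ha
    simp at ha ⊢
    tauto
  · rintro ⟨a, c⟩ h
    simp at h ⊢
    exact h.2.symm
  · intro a _
    rfl

/-- The increasing pairs inside a linearly ordered finite set make up half of its off-diagonal. -/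
theorem two_mul_card_increasing_pairs {α : Type*} [Fintype α] [LinearOrder α] (S : Finset α) :
    2 * (Finset.univ.filter
        (fun p : α × α => p.1 < p.2 ∧ p.1 ∈ S ∧ p.2 ∈ S)).card + S.card = S.card * S.card := by
  have hswap : (Finset.univ.filter
        (fun p : α × α => p.2 < p.1 ∧ p.1 ∈ S ∧ p.2 ∈ S)).card =
      (Finset.univ.filter (fun p : α × α => p.1 < p.2 ∧ p.1 ∈ S ∧ p.2 ∈ S)).card := by
    refine Finset.card_bij' (fun p _ => p.swap) (fun p _ => p.swap) ?_ ?_ ?_ ?_ <;>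
      simp +contextual
  have hoff : S.offDiag = Finset.univ.filter
        (fun p : α × α => p.1 < p.2 ∧ p.1 ∈ S ∧ p.2 ∈ S) ∪ Finset.univ.filter
        (fun p : α × α => p.2 < p.1 ∧ p.1 ∈ S ∧ p.2 ∈ S) := by
    ext ⟨a, b⟩
    simp only [Finset.mem_offDiag, Finset.mem_union, Finset.mem_filter, Finset.mem_univ, true_and,
      ne_iff_lt_or_gt]
    tauto
  have hcard := Finset.offDiag_card S
  rw [hoff, Finset.card_union_of_disjoint
    (Finset.disjoint_filter.2 fun p _ h h' => lt_asymm h.1 h'.1), hswap] at hcard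
  have := Nat.le_mul_self S.card
  omega

/-- For an `m`-subset `S` of `2m` points the number of pairs `a < b` with `a ∉ S`, `b ∈ S` is an
affine function of the signs of the indicator of `S`. -/
theorem card_inversions_eq_signed_sum {m : ℕ} (S : Finset (Fin (2 * m))) (hS : S.card = m) :
    ((Finset.univ.filter
        (fun p : Fin (2 * m) × Fin (2 * m) => p.1 < p.2 ∧ p.1 ∉ S ∧ p.2 ∈ S)).card : ℝ) =
      ((∑ b ∈ S, ((b : ℝ) - (2 * m - 1) / 2) / 2) +
        ∑ b ∈ Sᶜ, -(((b : ℝ) - (2 * m - 1) / 2) / 2)) + (m : ℝ) ^ 2 / 2 := by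
  have h1 := congrArg (Nat.cast : ℕ → ℝ) (card_inversions_add_card_pairs S)
  have h2 := congrArg (Nat.cast : ℕ → ℝ) (two_mul_card_increasing_pairs S)
  rw [hS] at h2
  push_cast at h1 h2
  have h3 : ∑ b : Fin (2 * m), (b : ℝ) = m * (2 * m - 1) := by
    have h4 := Finset.sum_range_id_mul_two (2 * m)
    rw [← Fin.sum_univ_eq_sum_range (fun i => i)] at h4
    rcases Nat.eq_zero_or_pos m with rfl | hm
    · simp
    · have h5 := congrArg (Nat.cast : ℕ → ℝ) h4
      push_cast [Nat.cast_sub (show 1 ≤ 2 * m by omega)] at h5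
      linarith
  rw [← Finset.sum_add_sum_compl S] at h3
  have hc : (Sᶜ.card : ℝ) = m := by
    rw [Finset.card_compl, hS, Fintype.card_fin]
    congr 1
    omega
  rw [Finset.sum_neg_distrib, ← Finset.sum_div, ← Finset.sum_div, Finset.sum_sub_distrib,
    Finset.sum_sub_distrib, Finset.sum_const, Finset.sum_const, nsmul_eq_mul, nsmul_eq_mul, hc, hS]
  linarith

/-- Moment generating function bound for independent random signs with bounded weights. -/
theorem sum_exp_signed_sum_le {α : Type*} [Fintype α] [DecidableEq α] (w : α → ℝ) (r : ℝ)
    (hw : ∀ a, w a ^ 2 ≤ r) :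
    ∑ S : Finset α, Real.exp ((∑ a ∈ S, w a) + ∑ a ∈ Sᶜ, -w a) ≤
      Real.exp (Fintype.card α * (Real.log 2 + r / 2)) := by
  have h : ∑ S : Finset α, Real.exp ((∑ a ∈ S, w a) + ∑ a ∈ Sᶜ, -w a) =
      ∏ a, (Real.exp (w a) + Real.exp (-w a)) := by
    rw [Finset.prod_add, Finset.powerset_univ]
    refine Finset.sum_congr rfl fun S _ => ?_
    rw [Real.exp_add, Real.exp_sum, Real.exp_sum, Finset.compl_eq_univ_sdiff]
  rw [h, Real.exp_nat_mul, ← Finset.card_univ, ← Finset.prod_const]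
  refine Finset.prod_le_prod (fun a _ => by positivity) fun a _ => ?_
  rw [Real.exp_add, Real.exp_log two_pos]
  have h1 := Real.cosh_le_exp_half_sq (w a)
  have h2 : Real.exp (w a ^ 2 / 2) ≤ Real.exp (r / 2) :=
    Real.exp_le_exp.2 (by linarith [hw a])
  rw [Real.cosh_eq] at h1
  linarith

/-- Gibbs' inequality against the exponential weights `exp ∘ u`. -/
theorem gibbs_entropy_le {α : Type*} [Fintype α] (P u : α → ℝ) (K : ℝ) (hP0 : ∀ a, 0 ≤ P a)
    (hP1 : ∑ a, P a = 1) (hu : ∑ a, Real.exp (u a) ≤ Real.exp K) :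
    -∑ a, P a * Real.log (P a) ≤ K - ∑ a, P a * u a := by
  have hpt : ∀ a, P a * (u a - K) - P a * Real.log (P a) ≤ Real.exp (u a - K) - P a := by
    intro a
    rcases (hP0 a).eq_or_lt with h | h
    · simp [← h, Real.exp_nonneg]
    · have h1 := Real.add_one_le_exp (u a - K - Real.log (P a))
      rw [Real.exp_sub _ (Real.log _), Real.exp_log h, le_div_iff₀ h] at h1
      linarith
  have hsum := Finset.sum_le_sum fun a (_ : a ∈ Finset.univ) => hpt a
  simp only [Finset.sum_sub_distrib, mul_sub, Real.exp_sub, ← Finset.sum_div, ← Finset.sum_mul,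
    hP1] at hsum
  have := (div_le_one (Real.exp_pos K)).2 hu
  linarith


/-- **Lemma 4.1 (Leighton–Moitra, transitive core).**  If `𝒴` is a random `m`-subset of
`[2m]` (distribution `P` supported on `m`-element subsets) with
`E|{(a,b) : a < b, a ∉ 𝒴, b ∈ 𝒴}| > (1/2 + ε)m²`, then `H(𝒴) ≤ (1 − ε²/8)·2m`. -/
theorem entropy_random_subset_le
    (ε : ℝ) (hε : 0 < ε)
    (m : ℕ) (hm : 0 < m)
    (P : Finset (Fin (2 * m)) → ℝ)
    (hP0 : ∀ S, 0 ≤ P S)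
    (hP1 : (∑ S : Finset (Fin (2 * m)), P S) = 1)
    (hsupp : ∀ S : Finset (Fin (2 * m)), S.card ≠ m → P S = 0)
    (hmean : (1 / 2 + ε) * (m : ℝ) ^ 2 <
      ∑ S : Finset (Fin (2 * m)), P S *
        ((Finset.univ.filter
          (fun p : Fin (2 * m) × Fin (2 * m) => p.1 < p.2 ∧ p.1 ∉ S ∧ p.2 ∈ S)).card : ℝ)) :
    (- ∑ S : Finset (Fin (2 * m)), P S * Real.logb 2 (P S)) ≤
      (1 - ε ^ 2 / 8) * (2 * (m : ℝ)) := by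
  have hmR : (0 : ℝ) < m := Nat.cast_pos.2 hm
  set c : Fin (2 * m) → ℝ := fun b => ((b : ℝ) - (2 * m - 1) / 2) / 2 with hc
  set g : Finset (Fin (2 * m)) → ℝ := fun S => (∑ b ∈ S, c b) + ∑ b ∈ Sᶜ, -c b with hg
  have hEg : ε * (m : ℝ) ^ 2 < ∑ S, P S * g S := by
    have h : ∀ S : Finset (Fin (2 * m)), P S * ((Finset.univ.filter
        (fun p : Fin (2 * m) × Fin (2 * m) => p.1 < p.2 ∧ p.1 ∉ S ∧ p.2 ∈ S)).card : ℝ) =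
        P S * g S + P S * ((m : ℝ) ^ 2 / 2) := by
      intro S
      by_cases hS : S.card = m
      · rw [card_inversions_eq_signed_sum S hS, mul_add]
      · simp [hsupp S hS]
    rw [Finset.sum_congr rfl fun S _ => h S, Finset.sum_add_distrib, ← Finset.sum_mul, hP1] at hmean
    linarith
  have hw : ∀ b, (2 * ε / m * c b) ^ 2 ≤ ε ^ 2 := by
    intro b
    have hb : (b : ℝ) + 1 ≤ 2 * m := by exact_mod_cast b.isLt
    have hb0 : (0 : ℝ) ≤ b := Nat.cast_nonneg _
    have hcb : |c b| ≤ m / 2 := abs_le.2 ⟨by simp only [hc]; linarith, by simp only [hc]; linarith⟩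
    refine sq_le_sq.2 ?_
    rw [abs_mul, abs_of_pos (by positivity : 0 < 2 * ε / (m : ℝ)), abs_of_pos hε]
    calc 2 * ε / m * |c b| ≤ 2 * ε / m * (m / 2) := by gcongr
      _ = ε := by field_simp
  have hmgf := sum_exp_signed_sum_le (fun b => 2 * ε / m * c b) (ε ^ 2) hw
  have hgibbs := gibbs_entropy_le P _ _ hP0 hP1 hmgf
  have hlin : ∑ S : Finset (Fin (2 * m)), P S *
      ((∑ b ∈ S, 2 * ε / m * c b) + ∑ b ∈ Sᶜ, -(2 * ε / m * c b)) =
      2 * ε / m * ∑ S, P S * g S := by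
    rw [Finset.mul_sum]
    refine Finset.sum_congr rfl fun S _ => ?_
    simp only [hg, Finset.sum_neg_distrib, ← Finset.mul_sum]
    ring
  have hgain : 2 * ε ^ 2 * m ≤ 2 * ε / m * ∑ S, P S * g S := by
    calc 2 * ε ^ 2 * m = 2 * ε / m * (ε * (m : ℝ) ^ 2) := by field_simp
      _ ≤ _ := by gcongr
  have hl2 : 0 < Real.log 2 := Real.log_pos one_lt_two
  have hl2' : Real.log 2 < 1 := by linarith [Real.log_two_lt_d9]
  rw [hlin, Fintype.card_fin] at hgibbs
  push_cast at hgibbs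
  simp only [Real.logb, ← mul_div_assoc]
  rw [← Finset.sum_div, ← neg_div, div_le_iff₀ hl2]
  have hpos : 0 < ε ^ 2 * m := by positivity
  have hle : ε ^ 2 * m * Real.log 2 ≤ ε ^ 2 * m := mul_le_of_le_one_right hpos.le hl2'.le
  linarith
end
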